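/- arXiv:1506.06223 — 2 statements merged into one kernel-verified Lean document; each statement's English description precedes it below -/
import Mathlib

section
/- Let n ≥ 3 and let φ: ℙ_n → ℙ_n be a continuous map satisfying φ(ABA) = φ(A)φ(B)φ(A) for all A, B ∈ ℙ_n. Then there exist a unitary matrix U ∈ 𝕄_n, a real number c, a set {P_1, …, P_n} of mutually orthogonal rank-one (orthogonal) projections in 𝕄_n, and real numbers c_1, …, c_n such that φ is of one of the following forms: (a1) φ(A) = (Det A)^c · U A U* for all A ∈ ℙ_n; (a2) φ(A) = (Det A)^c · U A^{-1} U*; (a3) φ(A) = (Det A)^c · U A^{tr} U*; (a4) φ(A) = (Det A)^c · U (A^{tr})^{-1} U*; (a5) φ(A) = Σ_{j=1}^n (Det A)^{c_j} P_j. -/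
open Matrix ComplexOrder

section part1
open Filter Topology NormedSpace

theorem jt_pow_sub_pow {R : Type*} [NormedRing R] [NormOneClass R] (x y : R) (C : ℝ) (hC : 1 ≤ C)
    (hx : ‖x‖ ≤ C) (hy : ‖y‖ ≤ C) (m : ℕ) : ‖x ^ m - y ^ m‖ ≤ m * ‖x - y‖ * C ^ m := by
  induction m with
  | zero => simp
  | succ k ih =>
    have h : x ^ (k+1) - y ^ (k+1) = x ^ k * (x - y) + (x ^ k - y ^ k) * y := by
      rw [pow_succ, pow_succ]; noncomm_ring
    have h1 : ‖x ^ k‖ ≤ C ^ k := (norm_pow_le x k).trans (pow_le_pow_left₀ (norm_nonneg _) hx k)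
    have hk : 0 ≤ C ^ k := by positivity
    have hk1 : C ^ k ≤ C ^ (k+1) := pow_le_pow_right₀ hC (by omega)
    calc ‖x ^ (k+1) - y ^ (k+1)‖ ≤ ‖x ^ k * (x - y)‖ + ‖(x ^ k - y ^ k) * y‖ := by
          rw [h]; exact norm_add_le _ _
      _ ≤ ‖x^k‖ * ‖x - y‖ + ‖x ^ k - y ^ k‖ * ‖y‖ := add_le_add (norm_mul_le _ _) (norm_mul_le _ _)
      _ ≤ C ^ (k+1) * ‖x - y‖ + (k * ‖x - y‖ * C ^ k) * C := by
          gcongr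
          exact h1.trans hk1
      _ = _ := by push_cast; ring

theorem jt_exp_tendsto {R : Type*} [NormedRing R] [NormedAlgebra ℝ R] [CompleteSpace R] (K : R) :
    Tendsto (fun m : ℕ => (m : ℝ) • (exp ((m : ℝ)⁻¹ • K) - 1)) atTop (𝓝 K) := by
  have h := hasDerivAt_exp_smul_const (𝕂 := ℝ) K 0
  simp only [zero_smul, exp_zero, one_mul] at h
  rw [hasDerivAt_iff_tendsto_slope] at h
  have h2 : Tendsto (fun m : ℕ => (m : ℝ)⁻¹) atTop (𝓝[≠] 0) := by
    rw [tendsto_nhdsWithin_iff]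
    refine ⟨tendsto_inv_atTop_nhds_zero_nat, ?_⟩
    filter_upwards [eventually_gt_atTop 0] with m hm
    simp; omega
  have h3 := h.comp h2
  refine h3.congr (fun m => ?_)
  simp [slope_def_module]

theorem jt_trotter {R : Type*} [NormedRing R] [NormOneClass R] [NormedAlgebra ℝ R] [CompleteSpace R]
    (X : ℕ → R) (K : R) (h : Tendsto (fun m : ℕ => (m : ℝ) • (X m - 1)) atTop (𝓝 K)) :
    Tendsto (fun m => X m ^ m) atTop (𝓝 (exp K)) := by
  let _ : NormedAlgebra ℚ R := NormedAlgebra.restrictScalars ℚ ℝ R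
  have hY := jt_exp_tendsto K
  set Y : ℕ → R := fun m => exp ((m : ℝ)⁻¹ • K) with hYd
  set C := ‖K‖ + 1
  have hC : 0 < C := by positivity
  have bd : ∀ Z : ℕ → R, Tendsto (fun m : ℕ => (m : ℝ) • (Z m - 1)) atTop (𝓝 K) →
      ∀ᶠ m : ℕ in atTop, ‖Z m‖ ≤ 1 + C / m := by
    intro Z hZ
    have := hZ.norm.eventually (gt_mem_nhds (show ‖K‖ < C by simp [C]))
    filter_upwards [this, eventually_gt_atTop 0] with m hm hm0
    have hm1 : (0:ℝ) < m := by exact_mod_cast hm0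
    rw [norm_smul, Real.norm_of_nonneg hm1.le] at hm
    have : ‖Z m - 1‖ ≤ C / m := by rw [le_div_iff₀ hm1]; linarith
    calc ‖Z m‖ = ‖1 + (Z m - 1)‖ := by congr 1; abel
      _ ≤ ‖(1:R)‖ + ‖Z m - 1‖ := norm_add_le _ _
      _ ≤ _ := by rw [norm_one]; linarith
  have hdiff : Tendsto (fun m => X m ^ m - Y m ^ m) atTop (𝓝 0) := by
    have h0 : Tendsto (fun m : ℕ => ‖(m : ℝ) • (X m - 1) - (m : ℝ) • (Y m - 1)‖ * Real.exp C)
        atTop (𝓝 0) := by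
      have := ((h.sub hY).norm).mul_const (Real.exp C)
      simpa using this
    refine squeeze_zero_norm' ?_ h0
    filter_upwards [bd X h, bd Y hY, eventually_gt_atTop 0] with m h1 h2 hm0
    have hm1 : (0:ℝ) < m := by exact_mod_cast hm0
    refine (jt_pow_sub_pow _ _ (1 + C / m) (by simp; positivity) h1 h2 m).trans ?_
    have e1 : (m : ℝ) • (X m - 1) - (m : ℝ) • (Y m - 1) = (m : ℝ) • (X m - Y m) := by
      rw [← smul_sub]; congr 1; abel
    rw [e1, norm_smul, Real.norm_of_nonneg hm1.le]
    gcongr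
    calc (1 + C / m) ^ m ≤ (Real.exp (C / m)) ^ m := by
          gcongr
          linarith [Real.add_one_le_exp (C / m)]
      _ = Real.exp C := by
          rw [← Real.exp_nat_mul]; congr 1; field_simp
  have hYm : ∀ᶠ m : ℕ in atTop, Y m ^ m = exp K := by
    filter_upwards [eventually_gt_atTop 0] with m hm0
    have hm1 : (m:ℝ) ≠ 0 := by positivity
    rw [hYd]
    simp only
    rw [← NormedSpace.exp_nsmul, ← Nat.cast_smul_eq_nsmul ℝ, smul_smul, mul_inv_cancel₀ hm1, one_smul]
  have h5 : Tendsto (fun m => Y m ^ m) atTop (𝓝 (exp K)) :=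
    tendsto_const_nhds.congr' (hYm.mono fun m hm => hm.symm)
  simpa using hdiff.add h5
end part1

section part2
open Filter Topology NormedSpace
open scoped Matrix.Norms.L2Operator

theorem jt_diag {n : ℕ} {H : Matrix (Fin n) (Fin n) ℂ} (hH : H.IsHermitian) :
    ∃ (U : Matrix (Fin n) (Fin n) ℂ) (d : Fin n → ℝ), U * Uᴴ = 1 ∧ Uᴴ * U = 1 ∧
      H = U * diagonal (fun i => (d i : ℂ)) * Uᴴ := by
  refine ⟨hH.eigenvectorUnitary, hH.eigenvalues, ?_, ?_, ?_⟩
  · exact Unitary.mul_star_self_of_mem hH.eigenvectorUnitary.2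
  · exact Unitary.star_mul_self_of_mem hH.eigenvectorUnitary.2
  · have := hH.spectral_theorem
    rw [Unitary.conjStarAlgAut_apply] at this
    exact this

theorem jt_exp_conj {n : ℕ} {U : Matrix (Fin n) (Fin n) ℂ} (h1 : U * Uᴴ = 1) 
    (A : Matrix (Fin n) (Fin n) ℂ) : exp (U * A * Uᴴ) = U * exp A * Uᴴ := by
  have h2 : Uᴴ = U⁻¹ := (Matrix.inv_eq_right_inv h1).symm
  rw [h2]
  exact Matrix.exp_conj U A (IsUnit.of_mul_eq_one _ h1)

theorem jt_exp_diag {n : ℕ} (d : Fin n → ℝ) :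
    exp (diagonal (fun i => (d i : ℂ))) = diagonal (fun i => ((Real.exp (d i) : ℝ) : ℂ)) := by
  rw [Matrix.exp_diagonal]
  congr 1
  ext i
  rw [Pi.coe_exp, ← Complex.exp_eq_exp_ℂ]
  simp

theorem jt_posDef_conj {n : ℕ} {U : Matrix (Fin n) (Fin n) ℂ} (h1 : U * Uᴴ = 1) (d : Fin n → ℝ)
    (hd : ∀ i, 0 < d i) : (U * diagonal (fun i => (d i : ℂ)) * Uᴴ).PosDef := by
  have hD : (diagonal (fun i => (d i : ℂ))).PosDef := by
    rw [Matrix.posDef_diagonal_iff]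
    intro i; exact_mod_cast hd i
  have := hD.conjTranspose_mul_mul_same (B := Uᴴ) (by
    apply Matrix.mulVec_injective_of_isUnit
    exact IsUnit.of_mul_eq_one_right _ h1)
  simpa using this

theorem jt_posDef_exp {n : ℕ} {H : Matrix (Fin n) (Fin n) ℂ} (hH : H.IsHermitian) :
    (exp H).PosDef := by
  obtain ⟨U, d, h1, h2, rfl⟩ := jt_diag hH
  rw [jt_exp_conj h1, jt_exp_diag]
  exact jt_posDef_conj h1 _ (fun i => Real.exp_pos _)

theorem jt_exists_log {n : ℕ} {A : Matrix (Fin n) (Fin n) ℂ} (hA : A.PosDef) :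
    ∃ H : Matrix (Fin n) (Fin n) ℂ, H.IsHermitian ∧ exp H = A := by
  obtain ⟨U, d, h1, h2, h3⟩ := jt_diag hA.1
  have hd : ∀ i, 0 < d i := by
    have h4 : (diagonal (fun i => (d i : ℂ))).PosDef := by
      have h5 : diagonal (fun i => (d i : ℂ)) = Uᴴ * A * U := by
        rw [h3]
        simp only [mul_assoc]; rw [h2, mul_one, ← mul_assoc, h2, one_mul]
      rw [h5]
      exact hA.conjTranspose_mul_mul_same (B := U) (by
        apply Matrix.mulVec_injective_of_isUnit
        exact IsUnit.of_mul_eq_one _ h1)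
    rw [Matrix.posDef_diagonal_iff] at h4
    intro i; exact_mod_cast h4 i
  refine ⟨U * diagonal (fun i => ((Real.log (d i) : ℝ) : ℂ)) * Uᴴ, ?_, ?_⟩
  · have : (diagonal (fun i => ((Real.log (d i) : ℝ) : ℂ))).IsHermitian := by
      apply Matrix.isHermitian_diagonal_of_self_adjoint
      ext i; simp
    exact Matrix.isHermitian_mul_mul_conjTranspose U this
  · rw [jt_exp_conj h1, jt_exp_diag, h3]
    simp only [Real.exp_log (hd _)]

theorem jt_exp_inj {n : ℕ} {A B : Matrix (Fin n) (Fin n) ℂ} (h : A.IsHermitian)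
    (h : B.IsHermitian) (e : exp A = exp B) : A = B := by
  rw [← CFC.log_exp A, e, CFC.log_exp B]

theorem jt_det_exp {n : ℕ} {H : Matrix (Fin n) (Fin n) ℂ} (hH : H.IsHermitian) :
    (exp H).det.re = Real.exp H.trace.re := by
  obtain ⟨U, d, h1, h2, rfl⟩ := jt_diag hH
  rw [jt_exp_conj h1, jt_exp_diag]
  have : (U * diagonal (fun i => ((Real.exp (d i) : ℝ) : ℂ)) * Uᴴ).det
      = (diagonal (fun i => ((Real.exp (d i) : ℝ) : ℂ))).det := by
    rw [Matrix.det_mul, Matrix.det_mul, mul_right_comm, ← Matrix.det_mul, h1]; simp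
  rw [this, Matrix.det_diagonal, Matrix.trace_mul_comm, ← mul_assoc, h2, one_mul, Matrix.trace_diagonal]
  rw [← Complex.ofReal_prod, ← Complex.ofReal_sum, Complex.ofReal_re, Complex.ofReal_re, Real.exp_sum]

theorem jt_conj_pd {n : ℕ} {A B : Matrix (Fin n) (Fin n) ℂ} (hA : A.PosDef) (hB : B.PosDef) :
    (A * B * A).PosDef := by
  have := hB.conjTranspose_mul_mul_same (B := A) (Matrix.mulVec_injective_of_isUnit hA.isUnit)
  rwa [hA.1.eq] at this

theorem jt_norm_one {n : ℕ} (hn : 0 < n) : NormOneClass (Matrix (Fin n) (Fin n) ℂ) := by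
  have : Nonempty (Fin n) := ⟨⟨0, hn⟩⟩
  exact ⟨CStarRing.norm_one⟩
end part2


section part3
open Filter Topology NormedSpace
open scoped Matrix.Norms.L2Operator

structure JTHom {n : ℕ} (φ : Matrix (Fin n) (Fin n) ℂ → Matrix (Fin n) (Fin n) ℂ) : Prop where
  maps : ∀ A : Matrix (Fin n) (Fin n) ℂ, A.PosDef → (φ A).PosDef
  cont : ContinuousOn φ {A : Matrix (Fin n) (Fin n) ℂ | A.PosDef}
  jordan : ∀ A B : Matrix (Fin n) (Fin n) ℂ, A.PosDef → B.PosDef →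
      φ (A * B * A) = φ A * φ B * φ A

variable {n : ℕ} {φ : Matrix (Fin n) (Fin n) ℂ → Matrix (Fin n) (Fin n) ℂ}

theorem jt_herm_rsmul {H : Matrix (Fin n) (Fin n) ℂ} (hH : H.IsHermitian) (t : ℝ) :
    (t • H).IsHermitian := by
  unfold Matrix.IsHermitian; rw [conjTranspose_smul, hH.eq]; simp

theorem jt_one (h : JTHom φ) : φ 1 = 1 := by
  have h1 : (1 : Matrix (Fin n) (Fin n) ℂ).PosDef := Matrix.PosDef.one
  obtain ⟨L, hL, hL2⟩ := jt_exists_log (h.maps 1 h1)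
  have h2 := h.jordan 1 1 h1 h1
  have hu : IsUnit (φ 1) := (h.maps 1 h1).isUnit
  have h3 : φ 1 * φ 1 = 1 := by
    apply hu.mul_right_cancel
    rw [← h2]; simp
  have h4 : exp ((2:ℕ) • L) = exp (0 : Matrix (Fin n) (Fin n) ℂ) := by
    rw [Matrix.exp_nsmul, hL2, pow_two, h3, exp_zero]
  have h5 := jt_exp_inj (by rw [← Nat.cast_smul_eq_nsmul ℝ]; exact jt_herm_rsmul hL _)
    (by simp) h4
  have h6 : L = 0 := by
    rw [← Nat.cast_smul_eq_nsmul ℝ] at h5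
    simpa using h5
  rw [← hL2, h6, exp_zero]

theorem jt_pow_pd {A : Matrix (Fin n) (Fin n) ℂ} (hA : A.PosDef) (k : ℕ) : (A ^ k).PosDef := by
  obtain ⟨H, hH, rfl⟩ := jt_exists_log hA
  rw [← Matrix.exp_nsmul, ← Nat.cast_smul_eq_nsmul ℝ]
  exact jt_posDef_exp (jt_herm_rsmul hH _)

theorem jt_pow (h : JTHom φ) {A : Matrix (Fin n) (Fin n) ℂ} (hA : A.PosDef) (k : ℕ) :
    φ (A ^ k) = φ A ^ k := by
  induction k using Nat.twoStepInduction with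
  | zero => simpa using jt_one h
  | one => simp
  | more k ih _ =>
    have e : ∀ B : Matrix (Fin n) (Fin n) ℂ, B ^ (k + 2) = B * B ^ k * B := fun B => by
      rw [← pow_succ', ← pow_succ]
    rw [e, e, h.jordan _ _ hA (jt_pow_pd hA k), ih]

theorem jt_inv (h : JTHom φ) {A : Matrix (Fin n) (Fin n) ℂ} (hA : A.PosDef) :
    φ (A⁻¹) = (φ A)⁻¹ := by
  have hu : IsUnit A.det := (Matrix.isUnit_iff_isUnit_det _).1 hA.isUnit
  have h1 := h.jordan A A⁻¹ hA hA.inv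
  rw [Matrix.mul_nonsing_inv _ hu, one_mul] at h1
  have hu2 : IsUnit (φ A) := (h.maps A hA).isUnit
  have h2 : φ A * φ A⁻¹ = 1 := by
    apply hu2.mul_right_cancel; rw [← h1, one_mul]
  exact (Matrix.inv_eq_right_inv h2).symm

theorem jt_exists_f (h : JTHom φ) : ∃ f : Matrix (Fin n) (Fin n) ℂ → Matrix (Fin n) (Fin n) ℂ,
    ∀ H : Matrix (Fin n) (Fin n) ℂ, H.IsHermitian → (f H).IsHermitian ∧ φ (exp H) = exp (f H) := by
  have : ∀ H : Matrix (Fin n) (Fin n) ℂ, ∃ L : Matrix (Fin n) (Fin n) ℂ, H.IsHermitian →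
      L.IsHermitian ∧ φ (exp H) = exp L := by
    intro H
    by_cases hH : H.IsHermitian
    · obtain ⟨L, h1, h2⟩ := jt_exists_log (h.maps _ (jt_posDef_exp hH))
      exact ⟨L, fun _ => ⟨h1, h2.symm⟩⟩
    · exact ⟨0, fun h => absurd h hH⟩
  choose f hf using this
  exact ⟨f, hf⟩

variable {f : Matrix (Fin n) (Fin n) ℂ → Matrix (Fin n) (Fin n) ℂ}

theorem jt_f_nat (h : JTHom φ) (hf : ∀ H : Matrix (Fin n) (Fin n) ℂ, H.IsHermitian →
    (f H).IsHermitian ∧ φ (exp H) = exp (f H)) {H : Matrix (Fin n) (Fin n) ℂ}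
    (hH : H.IsHermitian) (k : ℕ) : f ((k : ℝ) • H) = (k : ℝ) • f H := by
  apply jt_exp_inj (hf _ (jt_herm_rsmul hH _)).1 (jt_herm_rsmul (hf _ hH).1 _)
  rw [← (hf _ (jt_herm_rsmul hH _)).2, Nat.cast_smul_eq_nsmul, Matrix.exp_nsmul,
    jt_pow h (jt_posDef_exp hH), (hf _ hH).2, Nat.cast_smul_eq_nsmul, Matrix.exp_nsmul]

theorem jt_f_neg (h : JTHom φ) (hf : ∀ H : Matrix (Fin n) (Fin n) ℂ, H.IsHermitian →
    (f H).IsHermitian ∧ φ (exp H) = exp (f H)) {H : Matrix (Fin n) (Fin n) ℂ}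
    (hH : H.IsHermitian) : f (-H) = - f H := by
  apply jt_exp_inj (hf _ hH.neg).1 (hf _ hH).1.neg
  rw [← (hf _ hH.neg).2, Matrix.exp_neg, jt_inv h (jt_posDef_exp hH), (hf _ hH).2, Matrix.exp_neg]

theorem jt_f_int (h : JTHom φ) (hf : ∀ H : Matrix (Fin n) (Fin n) ℂ, H.IsHermitian →
    (f H).IsHermitian ∧ φ (exp H) = exp (f H)) {H : Matrix (Fin n) (Fin n) ℂ}
    (hH : H.IsHermitian) (k : ℤ) : f ((k : ℝ) • H) = (k : ℝ) • f H := by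
  obtain ⟨m, rfl | rfl⟩ := k.eq_nat_or_neg
  · exact_mod_cast jt_f_nat h hf hH m
  · have := jt_f_neg h hf (jt_herm_rsmul hH (m:ℝ))
    rw [jt_f_nat h hf hH] at this
    push_cast
    rw [neg_smul, neg_smul, this]

theorem jt_f_rat (h : JTHom φ) (hf : ∀ H : Matrix (Fin n) (Fin n) ℂ, H.IsHermitian →
    (f H).IsHermitian ∧ φ (exp H) = exp (f H)) {H : Matrix (Fin n) (Fin n) ℂ}
    (hH : H.IsHermitian) (q : ℚ) : f ((q : ℝ) • H) = (q : ℝ) • f H := by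
  have hd : (q.den : ℝ) ≠ 0 := by exact_mod_cast q.den_ne_zero
  have h1 := jt_f_nat h hf (jt_herm_rsmul hH (q : ℝ)) q.den
  have h2 := jt_f_int h hf hH q.num
  have e : (q.den : ℝ) * (q : ℝ) = q.num := by
    have := Rat.den_mul_eq_num q
    exact_mod_cast this
  rw [smul_smul, e, h2, ← e, ← smul_smul] at h1
  exact (smul_right_injective _ hd h1).symm

theorem jt_f_real (h : JTHom φ) (hf : ∀ H : Matrix (Fin n) (Fin n) ℂ, H.IsHermitian →
    (f H).IsHermitian ∧ φ (exp H) = exp (f H)) {H : Matrix (Fin n) (Fin n) ℂ}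
    (hH : H.IsHermitian) (t : ℝ) : f (t • H) = t • f H := by
  have hexp : Continuous (exp : Matrix (Fin n) (Fin n) ℂ → Matrix (Fin n) (Fin n) ℂ) :=
by
    let _ : NormedAlgebra ℚ (Matrix (Fin n) (Fin n) ℂ) := NormedAlgebra.restrictScalars ℚ ℝ _
    exact NormedSpace.exp_continuous
  have c1 : Continuous (fun t : ℝ => φ (exp (t • H))) := by
    apply h.cont.comp_continuous
    · fun_prop
    · intro t; exact jt_posDef_exp (jt_herm_rsmul hH t)
  have c2 : Continuous (fun t : ℝ => exp (t • f H)) := by fun_prop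
  have : (fun t : ℝ => φ (exp (t • H))) = (fun t : ℝ => exp (t • f H)) := by
    apply Continuous.ext_on Rat.denseRange_cast c1 c2
    rintro _ ⟨q, rfl⟩
    simp only
    rw [(hf _ (jt_herm_rsmul hH _)).2, jt_f_rat h hf hH]
  apply jt_exp_inj (hf _ (jt_herm_rsmul hH _)).1 (jt_herm_rsmul (hf _ hH).1 _)
  rw [← (hf _ (jt_herm_rsmul hH _)).2]
  exact congrFun this t

theorem jt_limit (hn : 0 < n) (h : JTHom φ) (X : ℕ → Matrix (Fin n) (Fin n) ℂ)
    (K K' : Matrix (Fin n) (Fin n) ℂ)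
    (hX : ∀ m, (X m).PosDef) (hK : K.IsHermitian)
    (h1 : Tendsto (fun m : ℕ => (m : ℝ) • (X m - 1)) atTop (𝓝 K))
    (h2 : Tendsto (fun m : ℕ => (m : ℝ) • (φ (X m) - 1)) atTop (𝓝 K')) :
    φ (exp K) = exp K' := by
  have := jt_norm_one hn
  have t1 := jt_trotter X K h1
  have t2 := jt_trotter _ K' h2
  have c := h.cont _ (jt_posDef_exp hK)
  have t3 : Tendsto (fun m => φ (X m ^ m)) atTop (𝓝 (φ (exp K))) := by
    apply c.tendsto.comp
    rw [tendsto_nhdsWithin_iff]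
    exact ⟨t1, Eventually.of_forall fun m => jt_pow_pd (hX m) m⟩
  simp only [jt_pow h (hX _)] at t3
  exact tendsto_nhds_unique t3 t2

theorem jt_tmul {X Y : ℕ → Matrix (Fin n) (Fin n) ℂ} {K L : Matrix (Fin n) (Fin n) ℂ}
    (h1 : Tendsto (fun m : ℕ => (m : ℝ) • (X m - 1)) atTop (𝓝 K))
    (h2 : Tendsto (fun m : ℕ => (m : ℝ) • (Y m - 1)) atTop (𝓝 L)) :
    Tendsto (fun m : ℕ => (m : ℝ) • (X m * Y m - 1)) atTop (𝓝 (K + L)) := by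
  have hY : Tendsto Y atTop (𝓝 1) := by
    have := (tendsto_inv_atTop_nhds_zero_nat (𝕜 := ℝ)).smul h2
    rw [zero_smul] at this
    have h3 := this.add_const (1 : Matrix (Fin n) (Fin n) ℂ)
    rw [zero_add] at h3
    refine h3.congr' ?_
    filter_upwards [eventually_gt_atTop 0] with m hm
    have : (m:ℝ) ≠ 0 := by positivity
    rw [smul_smul, inv_mul_cancel₀ this]; simp
  have := (h1.mul hY).add h2
  rw [mul_one] at this
  refine this.congr fun m => ?_
  rw [smul_mul_assoc, ← smul_add]; congr 1; noncomm_ring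

theorem jt_tconj {Y : ℕ → Matrix (Fin n) (Fin n) ℂ} {L : Matrix (Fin n) (Fin n) ℂ}
    (P Q : Matrix (Fin n) (Fin n) ℂ) (hPQ : P * Q = 1)
    (h2 : Tendsto (fun m : ℕ => (m : ℝ) • (Y m - 1)) atTop (𝓝 L)) :
    Tendsto (fun m : ℕ => (m : ℝ) • (P * Y m * Q - 1)) atTop (𝓝 (P * L * Q)) := by
  have := (h2.const_mul P).mul_const Q
  refine this.congr fun m => ?_
  rw [mul_smul_comm, smul_mul_assoc, mul_sub, sub_mul, mul_one, hPQ]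

theorem jt_phi_exp (h : JTHom φ) (hf : ∀ H : Matrix (Fin n) (Fin n) ℂ, H.IsHermitian →
    (f H).IsHermitian ∧ φ (exp H) = exp (f H)) {H : Matrix (Fin n) (Fin n) ℂ}
    (hH : H.IsHermitian) (t : ℝ) : φ (exp (t • H)) = exp (t • f H) := by
  rw [(hf _ (jt_herm_rsmul hH t)).2, jt_f_real h hf hH]

theorem jt_f_add (hn : 0 < n) (h : JTHom φ) (hf : ∀ H : Matrix (Fin n) (Fin n) ℂ, H.IsHermitian →
    (f H).IsHermitian ∧ φ (exp H) = exp (f H)) {A B : Matrix (Fin n) (Fin n) ℂ}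
    (hA : A.IsHermitian) (hB : B.IsHermitian) : f (A + B) = f A + f B := by
  have hA2 := jt_herm_rsmul hA (2⁻¹)
  have key := jt_limit hn h
    (fun m : ℕ => exp ((m:ℝ)⁻¹ • ((2⁻¹:ℝ) • A)) * exp ((m:ℝ)⁻¹ • B) * exp ((m:ℝ)⁻¹ • ((2⁻¹:ℝ) • A)))
    ((2⁻¹:ℝ) • A + B + (2⁻¹:ℝ) • A) (f ((2⁻¹:ℝ) • A) + f B + f ((2⁻¹:ℝ) • A)) 
    (fun m => jt_conj_pd (jt_posDef_exp (jt_herm_rsmul hA2 _)) (jt_posDef_exp (jt_herm_rsmul hB _)))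
    ((hA2.add hB).add hA2)
    (jt_tmul (jt_tmul (jt_exp_tendsto _) (jt_exp_tendsto _)) (jt_exp_tendsto _))
    (by
      have := jt_tmul (jt_tmul (jt_exp_tendsto (f ((2⁻¹:ℝ) • A))) (jt_exp_tendsto (f B)))
        (jt_exp_tendsto (f ((2⁻¹:ℝ) • A)))
      refine this.congr fun m => ?_
      rw [h.jordan _ _ (jt_posDef_exp (jt_herm_rsmul hA2 _)) (jt_posDef_exp (jt_herm_rsmul hB _)),
        jt_phi_exp h hf hA2, jt_phi_exp h hf hB])
  have e : ∀ A B : Matrix (Fin n) (Fin n) ℂ, (2⁻¹:ℝ) • A + B + (2⁻¹:ℝ) • A = A + B := by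
    intro A B
    rw [add_right_comm, ← add_smul]; norm_num
  rw [jt_f_real h hf hA, e, e, (hf _ (hA.add hB)).2] at key
  exact jt_exp_inj (hf _ (hA.add hB)).1 ((hf _ hA).1.add (hf _ hB).1) key

theorem jt_f_cosh (hn : 0 < n) (h : JTHom φ) (hf : ∀ H : Matrix (Fin n) (Fin n) ℂ, H.IsHermitian →
    (f H).IsHermitian ∧ φ (exp H) = exp (f H)) {A B : Matrix (Fin n) (Fin n) ℂ}
    (hA : A.IsHermitian) (hB : B.IsHermitian) :
    f (exp A * B * exp (-A) + exp (-A) * B * exp A) =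
      exp (f A) * f B * exp (-f A) + exp (-f A) * f B * exp (f A) := by
  have inv1 : ∀ A : Matrix (Fin n) (Fin n) ℂ, exp A * exp (-A) = 1 := fun A => by
    rw [← Matrix.exp_add_of_commute _ _ (Commute.refl A).neg_right]; simp
  have inv2 : ∀ A : Matrix (Fin n) (Fin n) ℂ, exp (-A) * exp A = 1 := fun A => by
    have := inv1 (-A); rwa [neg_neg] at this
  have herm : ∀ A B : Matrix (Fin n) (Fin n) ℂ, A.IsHermitian → B.IsHermitian → 
      (exp A * B * exp (-A) + exp (-A) * B * exp A).IsHermitian := by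
    intro A B hA hB
    unfold Matrix.IsHermitian
    rw [conjTranspose_add, conjTranspose_mul, conjTranspose_mul, conjTranspose_mul, 
      conjTranspose_mul, hA.exp.eq, hA.neg.exp.eq, hB.eq, add_comm]
    simp only [mul_assoc]
  have lim : ∀ A B : Matrix (Fin n) (Fin n) ℂ,
      Tendsto (fun m : ℕ => (m : ℝ) • (exp A * exp ((m:ℝ)⁻¹ • B) * exp (-A) * 
        (exp (-A) * exp ((m:ℝ)⁻¹ • B) * exp A) - 1)) atTop 
        (𝓝 (exp A * B * exp (-A) + exp (-A) * B * exp A)) := by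
    intro A B
    exact jt_tmul (jt_tconj _ _ (inv1 A) (jt_exp_tendsto B)) (jt_tconj _ _ (inv2 A) (jt_exp_tendsto B))
  have e : ∀ P Q Y : Matrix (Fin n) (Fin n) ℂ, P * Y * Q * (Q * Y * P) = 
      P * (Y * (Q * 1 * Q) * Y) * P := by intros; noncomm_ring
  have key := jt_limit hn h _ _ (exp (f A) * f B * exp (-f A) + exp (-f A) * f B * exp (f A)) 
    (fun m => by
      rw [e]
      refine jt_conj_pd (jt_posDef_exp hA) (jt_conj_pd (jt_posDef_exp (jt_herm_rsmul hB _))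
        (jt_conj_pd (jt_posDef_exp hA.neg) Matrix.PosDef.one)))
    (herm A B hA hB) (lim A B) (by
      refine (lim (f A) (f B)).congr fun m => ?_
      have pY := jt_posDef_exp (jt_herm_rsmul hB (m:ℝ)⁻¹)
      have pQ := jt_posDef_exp hA.neg
      have pP := jt_posDef_exp hA
      have p1 : (1 : Matrix (Fin n) (Fin n) ℂ).PosDef := Matrix.PosDef.one
      rw [e, e, h.jordan _ _ pP (jt_conj_pd pY (jt_conj_pd pQ p1)), 
        h.jordan _ _ pY (jt_conj_pd pQ p1), h.jordan _ _ pQ p1, jt_one h, (hf _ hA).2,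
        (hf _ hA.neg).2, jt_phi_exp h hf hB, jt_f_neg h hf hA])
  rw [(hf _ (herm A B hA hB)).2] at key
  exact jt_exp_inj (hf _ (herm A B hA hB)).1 (herm _ _ (hf _ hA).1 (hf _ hB).1) key
end part3


section part35
/-- commutator -/
def jtc {n : ℕ} (X Y : Matrix (Fin n) (Fin n) ℂ) : Matrix (Fin n) (Fin n) ℂ := X * Y - Y * X

variable {n : ℕ} (X Y Z : Matrix (Fin n) (Fin n) ℂ) (c : ℂ)
theorem jtc_add : jtc X (Y + Z) = jtc X Y + jtc X Z := by unfold jtc; noncomm_ring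
theorem add_jtc : jtc (X + Y) Z = jtc X Z + jtc Y Z := by unfold jtc; noncomm_ring
theorem jtc_sub : jtc X (Y - Z) = jtc X Y - jtc X Z := by unfold jtc; noncomm_ring
theorem sub_jtc : jtc (X - Y) Z = jtc X Z - jtc Y Z := by unfold jtc; noncomm_ring
theorem jtc_smul : jtc X (c • Y) = c • jtc X Y := by unfold jtc; simp [smul_sub]
theorem smul_jtc : jtc (c • X) Y = c • jtc X Y := by unfold jtc; simp [smul_sub]
theorem neg_jtc : jtc (-X) Y = - jtc X Y := by unfold jtc; noncomm_ring
theorem jtc_zero : jtc X 0 = 0 := by unfold jtc; noncomm_ring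
theorem zero_jtc : jtc 0 X = 0 := by unfold jtc; noncomm_ring

/-- star-preserving Lie triple homomorphisms -/
structure LTHom {n : ℕ} (F : Matrix (Fin n) (Fin n) ℂ →ₗ[ℂ] Matrix (Fin n) (Fin n) ℂ) : Prop where
  star : ∀ X, F Xᴴ = (F X)ᴴ
  lie : ∀ X Y Z, F (jtc X (jtc Y Z)) = jtc (F X) (jtc (F Y) (F Z))

theorem jt_lt_of_herm (F : Matrix (Fin n) (Fin n) ℂ →ₗ[ℂ] Matrix (Fin n) (Fin n) ℂ) 
    (q : ∀ A B : Matrix (Fin n) (Fin n) ℂ, A.IsHermitian → B.IsHermitian →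
      F (jtc A (jtc A B)) = jtc (F A) (jtc (F A) (F B)))
    (hre : ∀ X : Matrix (Fin n) (Fin n) ℂ, ∃ A B : Matrix (Fin n) (Fin n) ℂ, A.IsHermitian ∧
      B.IsHermitian ∧ X = A + Complex.I • B) (X Y Z : Matrix (Fin n) (Fin n) ℂ) :
    F (jtc X (jtc Y Z)) = jtc (F X) (jtc (F Y) (F Z)) := by
  have s : ∀ A B C : Matrix (Fin n) (Fin n) ℂ, A.IsHermitian → B.IsHermitian → C.IsHermitian →
      F (jtc A (jtc B C)) + F (jtc B (jtc A C)) = 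
      jtc (F A) (jtc (F B) (F C)) + jtc (F B) (jtc (F A) (F C)) := by
    intro A B C hA hB hC
    have h1 := q _ _ (hA.add hB) hC
    have h2 := q _ _ hA hC
    have h3 := q _ _ hB hC
    simp only [map_add, add_jtc, jtc_add] at h1
    rw [h2, h3] at h1
    rw [← sub_eq_zero] at h1 ⊢
    rw [← h1]; abel
  have t : ∀ A B C : Matrix (Fin n) (Fin n) ℂ, A.IsHermitian → B.IsHermitian → C.IsHermitian →
      F (jtc A (jtc B C)) = jtc (F A) (jtc (F B) (F C)) := by
    intro A B C hA hB hC
    have h1 := s A B C hA hB hC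
    have h2 := s A C B hA hC hB
    have J : ∀ A B C : Matrix (Fin n) (Fin n) ℂ, jtc A (jtc B C) + jtc B (jtc A C) - 
        (jtc A (jtc C B) + jtc C (jtc A B)) = (3:ℂ) • jtc A (jtc B C) := by
      intro A B C
      have : (3:ℂ) • jtc A (jtc B C) = jtc A (jtc B C) + jtc A (jtc B C) + jtc A (jtc B C) := by
        rw [← one_smul ℂ (jtc A (jtc B C)), ← add_smul, ← add_smul, smul_smul]; norm_num
      rw [this]
      simp only [jtc]; noncomm_ring
    have h3 := J A B C
    have h4 := congrArg F h3
    rw [map_sub, map_add, map_add, h1, h2, map_smul, J] at h4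
    exact (smul_right_injective _ (three_ne_zero) h4).symm
  have t1 : ∀ A B C : Matrix (Fin n) (Fin n) ℂ, A.IsHermitian → B.IsHermitian →
      F (jtc A (jtc B C)) = jtc (F A) (jtc (F B) (F C)) := by
    intro A B C hA hB
    obtain ⟨C1, C2, h1, h2, rfl⟩ := hre C
    simp only [jtc_add, jtc_smul, map_add, map_smul]
    rw [t A B _ hA hB h1, t A B _ hA hB h2]
  have t2 : ∀ A B C : Matrix (Fin n) (Fin n) ℂ, A.IsHermitian →
      F (jtc A (jtc B C)) = jtc (F A) (jtc (F B) (F C)) := by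
    intro A B C hA
    obtain ⟨C1, C2, h1, h2, rfl⟩ := hre B
    simp only [jtc_add, jtc_smul, add_jtc, smul_jtc, map_add, map_smul]
    rw [t1 A _ C hA h1, t1 A _ C hA h2]
  obtain ⟨C1, C2, h1, h2, rfl⟩ := hre X
  simp only [add_jtc, smul_jtc, map_add, map_smul]
  rw [t2 _ Y Z h1, t2 _ Y Z h2]
end part35


section part4
open Filter Topology NormedSpace
open scoped Matrix.Norms.L2Operator
variable {n : ℕ}

theorem jt_re_herm (X : Matrix (Fin n) (Fin n) ℂ) : ((2⁻¹:ℝ) • (X + Xᴴ)).IsHermitian := by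
  apply jt_herm_rsmul
  unfold Matrix.IsHermitian; simp [add_comm]

theorem jt_im_herm (X : Matrix (Fin n) (Fin n) ℂ) :
    ((2⁻¹:ℝ) • (Complex.I • (Xᴴ - X))).IsHermitian := by
  apply jt_herm_rsmul
  unfold Matrix.IsHermitian; simp [← smul_neg]

theorem jt_decomp (X : Matrix (Fin n) (Fin n) ℂ) :
    X = (2⁻¹:ℝ) • (X + Xᴴ) + Complex.I • ((2⁻¹:ℝ) • (Complex.I • (Xᴴ - X))) := by
  ext i j
  simp only [Matrix.add_apply, Matrix.smul_apply, Matrix.sub_apply, Complex.real_smul, smul_eq_mul]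
  push_cast
  linear_combination (1/2 : ℂ) * (X i j - Xᴴ i j) * Complex.I_mul_I

theorem jt_extend (f : Matrix (Fin n) (Fin n) ℂ → Matrix (Fin n) (Fin n) ℂ)
    (hh : ∀ A : Matrix (Fin n) (Fin n) ℂ, A.IsHermitian → (f A).IsHermitian)
    (hadd : ∀ A B : Matrix (Fin n) (Fin n) ℂ, A.IsHermitian → B.IsHermitian → f (A + B) = f A + f B)
    (hsmul : ∀ (t : ℝ) (A : Matrix (Fin n) (Fin n) ℂ), A.IsHermitian → f (t • A) = t • f A) :
    ∃ F : Matrix (Fin n) (Fin n) ℂ →ₗ[ℂ] Matrix (Fin n) (Fin n) ℂ,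
      (∀ X, F Xᴴ = (F X)ᴴ) ∧ ∀ A : Matrix (Fin n) (Fin n) ℂ, A.IsHermitian → F A = f A := by
  have h0 : f 0 = 0 := by
    have := hsmul 0 0 (by simp)
    simpa using this
  refine ⟨{ toFun := fun X => f ((2⁻¹:ℝ) • (X + Xᴴ)) + 
              Complex.I • f ((2⁻¹:ℝ) • (Complex.I • (Xᴴ - X)))
            map_add' := ?_
            map_smul' := ?_ }, ?_, ?_⟩
  · intro X Y
    have e1 : (2⁻¹:ℝ) • (X + Y + (X + Y)ᴴ) = (2⁻¹:ℝ) • (X + Xᴴ) + (2⁻¹:ℝ) • (Y + Yᴴ) := by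
      rw [← smul_add, conjTranspose_add]; congr 1; abel
    have e2 : (2⁻¹:ℝ) • (Complex.I • ((X + Y)ᴴ - (X + Y))) = 
        (2⁻¹:ℝ) • (Complex.I • (Xᴴ - X)) + (2⁻¹:ℝ) • (Complex.I • (Yᴴ - Y)) := by
      rw [← smul_add, ← smul_add, conjTranspose_add]; congr 2; abel
    rw [e1, e2, hadd _ _ (jt_re_herm X) (jt_re_herm Y), hadd _ _ (jt_im_herm X) (jt_im_herm Y),
      smul_add Complex.I]
    exact add_add_add_comm _ _ _ _
  · intro c X
    have e1 : (2⁻¹:ℝ) • (c • X + (c • X)ᴴ) = c.re • ((2⁻¹:ℝ) • (X + Xᴴ)) + 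
        (-c.im) • ((2⁻¹:ℝ) • (Complex.I • (Xᴴ - X))) := by
      ext i j
      simp only [Matrix.add_apply, Matrix.smul_apply, Matrix.sub_apply, Complex.real_smul, smul_eq_mul, 
        conjTranspose_smul, Complex.star_def]
      apply Complex.ext <;> simp <;> ring
    have e2 : (2⁻¹:ℝ) • (Complex.I • ((c • X)ᴴ - (c • X))) = 
        c.re • ((2⁻¹:ℝ) • (Complex.I • (Xᴴ - X))) + c.im • ((2⁻¹:ℝ) • (X + Xᴴ)) := by
      ext i j
      simp only [Matrix.add_apply, Matrix.smul_apply, Matrix.sub_apply, Complex.real_smul, smul_eq_mul, 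
        conjTranspose_smul, Complex.star_def]
      apply Complex.ext <;> simp <;> ring
    rw [e1, e2, hadd _ _ (jt_herm_rsmul (jt_re_herm X) _) (jt_herm_rsmul (jt_im_herm X) _),
      hadd _ _ (jt_herm_rsmul (jt_im_herm X) _) (jt_herm_rsmul (jt_re_herm X) _),
      hsmul _ _ (jt_re_herm X), hsmul _ _ (jt_re_herm X), hsmul _ _ (jt_im_herm X), 
      hsmul _ _ (jt_im_herm X)]
    ext i j
    simp only [Matrix.add_apply, Matrix.smul_apply, Complex.real_smul, smul_eq_mul, RingHom.id_apply]
    apply Complex.ext <;> simp <;> ring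
  · intro X
    simp only [LinearMap.coe_mk, AddHom.coe_mk, conjTranspose_conjTranspose, conjTranspose_add, 
      conjTranspose_smul, (hh _ (jt_re_herm X)).eq, (hh _ (jt_im_herm X)).eq]
    have e : (2⁻¹:ℝ) • (Complex.I • (X - Xᴴ)) = (-1 : ℝ) • ((2⁻¹:ℝ) • (Complex.I • (Xᴴ - X))) := by
      ext i j
      simp only [Matrix.smul_apply, Matrix.sub_apply, Complex.real_smul, smul_eq_mul]
      push_cast; ring
    rw [e, hsmul _ _ (jt_im_herm X), add_comm Xᴴ X]
    simp
  · intro A hA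
    simp only [LinearMap.coe_mk, AddHom.coe_mk, hA.eq, sub_self, smul_zero, h0, add_zero]
    rw [← two_smul ℝ A, smul_smul]; norm_num

theorem jt_deriv_conj (A B : Matrix (Fin n) (Fin n) ℂ) (s : ℝ) :
    HasDerivAt (fun t : ℝ => exp (t • A) * B * exp (t • (-A))) 
      (exp (s • A) * (jtc A B) * exp (s • (-A))) s := by
  have h1 := hasDerivAt_exp_smul_const (𝕂 := ℝ) A s
  have h2 := hasDerivAt_exp_smul_const' (𝕂 := ℝ) (-A) s
  have := (h1.mul_const B).mul h2
  refine HasDerivAt.congr_deriv this ?_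
  unfold jtc; noncomm_ring

theorem jt_lie_of_cosh (F : Matrix (Fin n) (Fin n) ℂ →ₗ[ℂ] Matrix (Fin n) (Fin n) ℂ)
    (A B : Matrix (Fin n) (Fin n) ℂ)
    (h : ∀ t : ℝ, F (exp (t • A) * B * exp (t • (-A)) + exp (t • (-A)) * B * exp (t • A)) =
      exp (t • F A) * F B * exp (t • (-F A)) + exp (t • (-F A)) * F B * exp (t • F A)) :
    F (jtc A (jtc A B)) = jtc (F A) (jtc (F A) (F B)) := by
  let Fc : Matrix (Fin n) (Fin n) ℂ →L[ℝ] Matrix (Fin n) (Fin n) ℂ :=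
    LinearMap.toContinuousLinearMap (F.restrictScalars ℝ)
  have hFc : ∀ X, Fc X = F X := fun X => rfl
  have d1 : ∀ A B : Matrix (Fin n) (Fin n) ℂ, ∀ s : ℝ, 
      HasDerivAt (fun t : ℝ => exp (t • A) * B * exp (t • (-A)) + exp (t • (-A)) * B * exp (t • A)) 
      (exp (s • A) * (jtc A B) * exp (s • (-A)) - exp (s • (-A)) * (jtc A B) * exp (s • A)) s := by
    intro A B s
    have := (jt_deriv_conj A B s).add (jt_deriv_conj (-A) B s)
    rw [neg_neg] at this
    refine HasDerivAt.congr_deriv this ?_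
    rw [neg_jtc]; noncomm_ring
  have d2 : ∀ A B : Matrix (Fin n) (Fin n) ℂ, 
      HasDerivAt (fun t : ℝ => exp (t • A) * B * exp (t • (-A)) - exp (t • (-A)) * B * exp (t • A)) 
      ((2:ℝ) • jtc A B) 0 := by
    intro A B
    have := (jt_deriv_conj A B 0).sub (jt_deriv_conj (-A) B 0)
    rw [neg_neg] at this
    refine HasDerivAt.congr_deriv this ?_
    rw [neg_jtc]; simp [two_smul]
  have e1 : ∀ s : ℝ, F (exp (s • A) * (jtc A B) * exp (s • (-A)) - exp (s • (-A)) * (jtc A B) * exp (s • A))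
      = exp (s • F A) * (jtc (F A) (F B)) * exp (s • (-F A)) - exp (s • (-F A)) * (jtc (F A) (F B)) * exp (s • F A) := by
    intro s
    have g1 := Fc.hasFDerivAt.comp_hasDerivAt s (d1 A B s)
    have g2 := d1 (F A) (F B) s
    have e : (⇑Fc ∘ fun t : ℝ => exp (t • A) * B * exp (t • (-A)) + exp (t • (-A)) * B * exp (t • A)) =
       (fun t : ℝ => exp (t • F A) * F B * exp (t • (-F A)) + exp (t • (-F A)) * F B * exp (t • F A)) := by
      funext t; exact h t
    rw [e] at g1
    exact g1.unique g2
  have g1 := Fc.hasFDerivAt.comp_hasDerivAt 0 (d2 A (jtc A B))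
  have g2 := d2 (F A) (jtc (F A) (F B))
  have e : (⇑Fc ∘ fun t : ℝ => exp (t • A) * (jtc A B) * exp (t • (-A)) - exp (t • (-A)) * (jtc A B) * exp (t • A)) =
     (fun t : ℝ => exp (t • F A) * (jtc (F A) (F B)) * exp (t • (-F A)) - exp (t • (-F A)) * (jtc (F A) (F B)) * exp (t • F A)) := by
    funext t; exact e1 t
  rw [e] at g1
  have := g1.unique g2
  rw [map_smul] at this
  exact smul_right_injective _ (two_ne_zero) this

theorem jt_exists_F (hn : 0 < n) {φ : Matrix (Fin n) (Fin n) ℂ → Matrix (Fin n) (Fin n) ℂ}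
    (h : JTHom φ) : ∃ F : Matrix (Fin n) (Fin n) ℂ →ₗ[ℂ] Matrix (Fin n) (Fin n) ℂ, LTHom F ∧
      ∀ H : Matrix (Fin n) (Fin n) ℂ, H.IsHermitian → φ (exp H) = exp (F H) := by
  obtain ⟨f, hf⟩ := jt_exists_f h
  obtain ⟨F, hF1, hF2⟩ := jt_extend f (fun A hA => (hf A hA).1)
    (fun A B hA hB => jt_f_add hn h hf hA hB) (fun t A hA => jt_f_real h hf hA t)
  refine ⟨F, ⟨hF1, ?_⟩, fun H hH => by rw [hF2 H hH]; exact (hf H hH).2⟩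
  have q : ∀ A B : Matrix (Fin n) (Fin n) ℂ, A.IsHermitian → B.IsHermitian →
      F (jtc A (jtc A B)) = jtc (F A) (jtc (F A) (F B)) := by
    intro A B hA hB
    apply jt_lie_of_cosh
    intro t
    have hA' := jt_herm_rsmul hA t
    have := jt_f_cosh hn h hf hA' hB
    rw [← hF2 _ hA', ← hF2 _ hB, ← hF2] at this
    · rw [← Complex.coe_smul t A, map_smul, Complex.coe_smul, Complex.coe_smul] at this
      rwa [smul_neg, smul_neg]
    · unfold Matrix.IsHermitian
      rw [conjTranspose_add, conjTranspose_mul, conjTranspose_mul, conjTranspose_mul, 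
        conjTranspose_mul, hA'.exp.eq, hA'.neg.exp.eq, hB.eq, add_comm]
      simp only [mul_assoc]
  exact jt_lt_of_herm F q (fun X => ⟨_, _, jt_re_herm X, jt_im_herm X, jt_decomp X⟩)
end part4


section part5
variable {n : ℕ}

/-- matrix units -/
def jtE {n : ℕ} (i j : Fin n) : Matrix (Fin n) (Fin n) ℂ := Matrix.single i j 1

theorem jtE_apply (i j a b : Fin n) : jtE i j a b = if i = a ∧ j = b then 1 else 0 := rfl

theorem jtE_mul (i j k l : Fin n) : jtE i j * jtE k l = if j = k then jtE i l else 0 := by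
  unfold jtE
  split_ifs with h
  · subst h; simp
  · simp [Matrix.single_mul_single_of_ne, h]

theorem jtE_star (i j : Fin n) : (jtE i j)ᴴ = jtE j i := by
  unfold jtE; simp

theorem jtE_transpose (i j : Fin n) : (jtE i j)ᵀ = jtE j i := by
  unfold jtE; simp

theorem jtE_ne (i j : Fin n) : jtE i j ≠ 0 := by
  intro h
  have := congrFun (congrFun h i) j
  simp [jtE_apply] at this

theorem jtE_smul_inj {a b c d : Fin n} {z w : ℂ} (hz : z ≠ 0) (h : z • jtE a b = w • jtE c d) :
    a = c ∧ b = d ∧ z = w := by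
  have h1 := congrFun (congrFun h a) b
  simp only [Matrix.smul_apply, jtE_apply, and_self, if_true, smul_eq_mul, mul_one] at h1
  by_cases hc : c = a ∧ d = b
  · simp only [hc, and_self, if_true, mul_one] at h1
    exact ⟨hc.1.symm, hc.2.symm, h1⟩
  · simp only [hc, if_false, mul_zero] at h1
    exact absurd h1 hz

theorem jt_expand (X : Matrix (Fin n) (Fin n) ℂ) : X = ∑ i, ∑ j, X i j • jtE i j := by
  conv_lhs => rw [Matrix.matrix_eq_sum_single X]
  simp [jtE, Matrix.smul_single]

theorem jt_trace_lemma (K : Matrix (Fin n) (Fin n) ℂ →ₗ[ℂ] Matrix (Fin n) (Fin n) ℂ) (i0 : Fin n)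
    (h1 : ∀ i j, i ≠ j → K (jtE i j) = 0) (h2 : ∀ i, K (jtE i i) = K (jtE i0 i0))
    (X : Matrix (Fin n) (Fin n) ℂ) : K X = X.trace • K (jtE i0 i0) := by
  conv_lhs => rw [jt_expand X]
  simp only [map_sum, map_smul]
  rw [Matrix.trace, Finset.sum_smul]
  refine Finset.sum_congr rfl fun i _ => ?_
  rw [Finset.sum_eq_single i]
  · rw [h2]; rfl
  · intro j _ hj; rw [h1 i j hj.symm, smul_zero]
  · simp

theorem jt_third (hn : 3 ≤ n) (i j : Fin n) : ∃ k : Fin n, k ≠ i ∧ k ≠ j := by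
  by_contra! h
  have : (Finset.univ : Finset (Fin n)) ⊆ {i, j} := by
    intro k _
    by_cases hk : k = i
    · simp [hk]
    · simp [h k hk]
  have h2 := Finset.card_le_card this
  have h3 := Finset.card_le_two (a := i) (b := j)
  simp at h2; omega

/-- conjugation -/
def jtConj {n : ℕ} (F : Matrix (Fin n) (Fin n) ℂ →ₗ[ℂ] Matrix (Fin n) (Fin n) ℂ)
    (U : Matrix (Fin n) (Fin n) ℂ) : Matrix (Fin n) (Fin n) ℂ →ₗ[ℂ] Matrix (Fin n) (Fin n) ℂ where
  toFun X := Uᴴ * F X * U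
  map_add' X Y := by rw [map_add]; noncomm_ring
  map_smul' c X := by rw [map_smul]; simp

/-- transposition -/
def jtTr {n : ℕ} (F : Matrix (Fin n) (Fin n) ℂ →ₗ[ℂ] Matrix (Fin n) (Fin n) ℂ) :
    Matrix (Fin n) (Fin n) ℂ →ₗ[ℂ] Matrix (Fin n) (Fin n) ℂ where
  toFun X := (F X)ᵀ
  map_add' X Y := by rw [map_add]; simp
  map_smul' c X := by rw [map_smul]; simp

theorem jtConj_apply (F : Matrix (Fin n) (Fin n) ℂ →ₗ[ℂ] Matrix (Fin n) (Fin n) ℂ)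
    (U X : Matrix (Fin n) (Fin n) ℂ) : jtConj F U X = Uᴴ * F X * U := rfl

theorem jtTr_apply (F : Matrix (Fin n) (Fin n) ℂ →ₗ[ℂ] Matrix (Fin n) (Fin n) ℂ)
    (X : Matrix (Fin n) (Fin n) ℂ) : jtTr F X = (F X)ᵀ := rfl

variable {F : Matrix (Fin n) (Fin n) ℂ →ₗ[ℂ] Matrix (Fin n) (Fin n) ℂ}

theorem jtConj_lt (h : LTHom F) {U : Matrix (Fin n) (Fin n) ℂ} (hU : U * Uᴴ = 1) :
    LTHom (jtConj F U) := by
  refine ⟨fun X => ?_, fun X Y Z => ?_⟩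
  · simp only [jtConj_apply, h.star, conjTranspose_mul, conjTranspose_conjTranspose, mul_assoc]
  · simp only [jtConj_apply, h.lie]
    have e : ∀ P Q : Matrix (Fin n) (Fin n) ℂ, 
        jtc (Uᴴ * P * U) (Uᴴ * Q * U) = Uᴴ * jtc P Q * U := by
      intro P Q
      have : ∀ P Q : Matrix (Fin n) (Fin n) ℂ, (Uᴴ * P * U) * (Uᴴ * Q * U) = Uᴴ * (P * Q) * U := by
        intro P Q
        calc (Uᴴ * P * U) * (Uᴴ * Q * U) = Uᴴ * P * (U * Uᴴ) * Q * U := by simp only [mul_assoc]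
          _ = _ := by rw [hU, mul_one]; simp only [mul_assoc]
      rw [jtc, this, this, jtc]; noncomm_ring
    rw [e, e]

theorem jtTr_lt (h : LTHom F) : LTHom (jtTr F) := by
  refine ⟨fun X => ?_, fun X Y Z => ?_⟩
  · simp only [jtTr_apply, h.star]; rfl
  · rw [jtTr_apply, h.lie]
    simp only [jtTr_apply, jtc, Matrix.transpose_sub, Matrix.transpose_mul]
    noncomm_ring

theorem jt_lie_diff {i j k : Fin n} (hij : i ≠ j) (hjk : j ≠ k) (hik : i ≠ k) :
    jtc (jtE i j) (jtc (jtE j k) (jtE k i)) = jtE i i - jtE j j := by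
  simp [jtc, jtE_mul, hij]

theorem jt_caseA (hn : 3 ≤ n) (h : LTHom F) {i j : Fin n} (hij : i ≠ j) (h0 : F (jtE i j) = 0)
    (i0 : Fin n) : ∀ X, F X = X.trace • F (jtE i0 i0) := by
  have r1 : ∀ i j k : Fin n, i ≠ j → k ≠ j → F (jtE i j) = 0 → F (jtE k j) = 0 := by
    intro i j k hij hkj h0
    by_cases hki : k = i
    · rw [hki]; exact h0
    have e : jtc (jtE j j) (jtc (jtE k i) (jtE i j)) = - jtE k j := by
      simp [jtc, jtE_mul, hkj.symm]
    have := h.lie (jtE j j) (jtE k i) (jtE i j)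
    rw [e, h0, jtc_zero, jtc_zero, map_neg, neg_eq_zero] at this
    exact this
  have r2 : ∀ i j, F (jtE i j) = 0 → F (jtE j i) = 0 := by
    intro i j h0
    rw [← jtE_star, h.star, h0]; simp
  have r3 : ∀ k l : Fin n, k ≠ l → F (jtE k l) = 0 := by
    intro k l hkl
    by_cases hkj : k = j
    · subst hkj
      have a1 := r2 _ _ h0
      exact r2 _ _ (r1 _ _ _ hij hkl.symm h0)
    · have a1 := r2 _ _ (r1 _ _ _ hij hkj h0)
      exact r2 _ _ (r1 _ _ _ (Ne.symm hkj) hkl.symm a1)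
  apply jt_trace_lemma F i0 r3
  intro i
  by_cases hi : i = i0
  · rw [hi]
  obtain ⟨k, hk1, hk2⟩ := jt_third hn i i0
  have := h.lie (jtE i i0) (jtE i0 k) (jtE k i)
  rw [jt_lie_diff hi hk2.symm hk1.symm, r3 _ _ hi, zero_jtc, map_sub, sub_eq_zero] at this
  exact this

theorem jt_comb (d μ : Fin n → ℝ)
    (hd : ∀ i j k l, i < j → k < l → (d i - d j)^2 = (d k - d l)^2 → i = k ∧ j = l)
    (hd0 : ∀ i j, i < j → d i ≠ d j)
    (hex : ∀ i j, i < j → ∃ a b, (μ a - μ b)^2 = (d i - d j)^2) :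
    (∀ a b, a < b → μ a ≠ μ b) ∧
    ∀ a b c e, a < b → c < e → (μ a - μ b)^2 = (μ c - μ e)^2 → a = c ∧ b = e := by
  have hex2 : ∀ p : {p : Fin n × Fin n // p.1 < p.2}, ∃ q : {p : Fin n × Fin n // p.1 < p.2},
      (μ q.1.1 - μ q.1.2)^2 = (d p.1.1 - d p.1.2)^2 := by
    rintro ⟨⟨i, j⟩, hij⟩
    obtain ⟨a, b, hab⟩ := hex i j hij
    rcases lt_trichotomy a b with h | h | h
    · exact ⟨⟨(a, b), h⟩, hab⟩
    · subst h
      exfalso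
      simp only [sub_self] at hab
      have : d i - d j = 0 := by
        have h2 : (d i - d j)^2 = 0 := by rw [← hab]; norm_num
        exact pow_eq_zero_iff (two_ne_zero) |>.1 h2
      exact hd0 i j hij (by linarith)
    · exact ⟨⟨(b, a), h⟩, by simp only; rw [← hab]; ring⟩
  choose g hg using hex2
  have ginj : Function.Injective g := by
    rintro ⟨⟨i, j⟩, hij⟩ ⟨⟨k, l⟩, hkl⟩ e
    have h1 := hg ⟨(i, j), hij⟩
    have h2 := hg ⟨(k, l), hkl⟩
    rw [e, h2] at h1
    have := hd k l i j hkl hij h1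
    simp [this]
  have gsurj := Finite.injective_iff_surjective.1 ginj
  constructor
  · intro a b hab e
    obtain ⟨⟨⟨i, j⟩, hij⟩, hp⟩ := gsurj ⟨(a, b), hab⟩
    have h1 := hg ⟨(i, j), hij⟩
    rw [hp] at h1
    simp only [e, sub_self] at h1
    have h2 : (d i - d j)^2 = 0 := by rw [← h1]; norm_num
    have := pow_eq_zero_iff (two_ne_zero) |>.1 h2
    exact hd0 i j hij (by linarith)
  · intro a b c e hab hce heq
    obtain ⟨⟨⟨i, j⟩, hij⟩, hp⟩ := gsurj ⟨(a, b), hab⟩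
    obtain ⟨⟨⟨k, l⟩, hkl⟩, hq⟩ := gsurj ⟨(c, e), hce⟩
    have h1 := hg ⟨(i, j), hij⟩
    have h2 := hg ⟨(k, l), hkl⟩
    rw [hp] at h1
    rw [hq] at h2
    simp only at h1 h2
    rw [heq, h2] at h1
    obtain ⟨rfl, rfl⟩ := hd k l i j hkl hij h1
    rw [hp] at hq
    simpa using hq

theorem jt_pow_two (i j k l : ℕ) (hij : i < j) (hkl : k < l)
    (h : 2 ^ j + 2 ^ k = 2 ^ l + 2 ^ i) : i = k ∧ j = l := by
  have aux : ∀ i j k l : ℕ, i < j → k < l → 2 ^ j + 2 ^ k = 2 ^ l + 2 ^ i → ¬ i < k := by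
    intro i j k l hij hkl h hik
    obtain ⟨p, rfl⟩ := Nat.exists_eq_add_of_lt hij
    obtain ⟨q, rfl⟩ := Nat.exists_eq_add_of_lt hik
    obtain ⟨r, rfl⟩ := Nat.exists_eq_add_of_lt hkl
    have hp : 0 < 2 ^ i := by positivity
    have h2 : 2 ^ i * (2 * 2 ^ p + 2 * 2 ^ q) = 2 ^ i * (2 * 2 ^ (q + r + 1) + 1) := by
      have : 2 ^ i * (2 * 2 ^ p + 2 * 2 ^ q) = 2 ^ (i + p + 1) + 2 ^ (i + q + 1) := by ring
      rw [this, h]; ring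
    have h3 := Nat.eq_of_mul_eq_mul_left hp h2
    omega
  have h1 := aux i j k l hij hkl h
  have h2 := aux k l i j hkl hij (by omega)
  have h3 : i = k := by omega
  subst h3
  exact ⟨rfl, Nat.pow_right_injective (le_refl 2) (by simpa using h)⟩

theorem jt_d_sidon (i j k l : Fin n) (hij : i < j) (hkl : k < l)
    (h : (((2:ℝ) ^ (i:ℕ)) - (2:ℝ) ^ (j:ℕ))^2 = ((2:ℝ) ^ (k:ℕ) - (2:ℝ) ^ (l:ℕ))^2) : i = k ∧ j = l := by
  have h1 : (2:ℝ) ^ (i:ℕ) < 2 ^ (j:ℕ) := pow_lt_pow_right₀ (by norm_num) hij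
  have h2 : (2:ℝ) ^ (k:ℕ) < 2 ^ (l:ℕ) := pow_lt_pow_right₀ (by norm_num) hkl
  have h3 : (2:ℝ) ^ (j:ℕ) + 2 ^ (k:ℕ) = 2 ^ (l:ℕ) + 2 ^ (i:ℕ) := by
    rcases sq_eq_sq_iff_eq_or_eq_neg.1 h with h | h <;> linarith
  have h4 : 2 ^ (j:ℕ) + 2 ^ (k:ℕ) = 2 ^ (l:ℕ) + 2 ^ (i:ℕ) := by exact_mod_cast h3
  have := jt_pow_two i j k l hij hkl h4
  exact ⟨Fin.ext this.1, Fin.ext this.2⟩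

/-- monomial maps -/
structure JTMono {n : ℕ} (G : Matrix (Fin n) (Fin n) ℂ →ₗ[ℂ] Matrix (Fin n) (Fin n) ℂ) : Prop where
  off : ∀ i j, i ≠ j → ∃ (a b : Fin n) (z : ℂ), a ≠ b ∧ z * star z = 1 ∧ G (jtE i j) = z • jtE a b
  dia : ∀ i j a b, a ≠ b → G (jtE i i - jtE j j) a b = 0

theorem jt_diag_lie (μ : Fin n → ℂ) (X : Matrix (Fin n) (Fin n) ℂ) (a b : Fin n) :
    jtc (diagonal μ) (jtc (diagonal μ) X) a b = (μ a - μ b)^2 * X a b := by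
  simp only [jtc, Matrix.sub_apply, Matrix.diagonal_mul, Matrix.mul_diagonal]
  ring

theorem jt_mono_of_diag (h : LTHom F) (hne : ∀ i j, i ≠ j → F (jtE i j) ≠ 0)
    (μ : Fin n → ℝ)
    (hD : F (diagonal (fun i : Fin n => (((2:ℝ) ^ (i:ℕ) : ℝ) : ℂ))) = diagonal (fun i => (μ i : ℂ))) :
    JTMono F := by
  set d : Fin n → ℝ := fun i => (2:ℝ) ^ (i:ℕ) with hdd
  have ent : ∀ i j a b, F (jtE i j) a b ≠ 0 → (μ a - μ b)^2 = (d i - d j)^2 := by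
    intro i j a b hab
    have h1 := h.lie (diagonal (fun i => (d i : ℂ))) (diagonal (fun i => (d i : ℂ))) (jtE i j)
    have h2 : jtc (diagonal (fun i => (d i : ℂ))) (jtc (diagonal (fun i => (d i : ℂ))) (jtE i j)) =
        ((d i : ℂ) - d j)^2 • jtE i j := by
      ext a b
      rw [jt_diag_lie, Matrix.smul_apply, smul_eq_mul, jtE_apply]
      split_ifs with hh
      · rw [hh.1, hh.2]
      · simp
    rw [h2, hD, map_smul] at h1
    have h3 := congrFun (congrFun h1 a) b
    rw [jt_diag_lie, Matrix.smul_apply, smul_eq_mul] at h3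
    have h4 := mul_right_cancel₀ hab h3
    exact_mod_cast h4.symm
  have hd0 : ∀ i j, i < j → d i ≠ d j := fun i j hij => 
    ne_of_lt (pow_lt_pow_right₀ (by norm_num) hij)
  have hd1 : ∀ i j, i ≠ j → (d i - d j)^2 ≠ 0 := by
    intro i j hij
    apply pow_ne_zero
    rcases lt_or_gt_of_ne hij with hh | hh
    · exact sub_ne_zero.2 (hd0 _ _ hh)
    · exact sub_ne_zero.2 (hd0 _ _ hh).symm
  have hsome : ∀ i j, i ≠ j → ∃ a b, F (jtE i j) a b ≠ 0 := by
    intro i j hij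
    by_contra! hc
    exact hne i j hij (by ext a b; simpa using hc a b)
  obtain ⟨hμ0, hμ⟩ := jt_comb d μ jt_d_sidon hd0 (fun i j hij => by
    obtain ⟨a, b, hab⟩ := hsome i j hij.ne
    exact ⟨a, b, ent i j a b hab⟩)
  have hμ1 : ∀ a b, a ≠ b → μ a ≠ μ b := by
    intro a b hab
    rcases lt_or_gt_of_ne hab with hh | hh
    · exact hμ0 _ _ hh
    · exact (hμ0 _ _ hh).symm
  have hμ2 : ∀ a b c e, a ≠ b → c ≠ e → (μ a - μ b)^2 = (μ c - μ e)^2 → 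
      (a = c ∧ b = e) ∨ (a = e ∧ b = c) := by
    intro a b c e hab hce heq
    rcases lt_or_gt_of_ne hab with h1 | h1 <;> rcases lt_or_gt_of_ne hce with h2 | h2
    · exact Or.inl (hμ _ _ _ _ h1 h2 heq)
    · exact Or.inr (hμ _ _ _ _ h1 h2 (by rw [heq]; ring))
    · have := hμ _ _ _ _ h1 h2 (by rw [← heq]; ring)
      exact Or.inr ⟨this.2, this.1⟩
    · have := hμ _ _ _ _ h1 h2 (by linear_combination heq)
      exact Or.inl ⟨this.2, this.1⟩
  constructor
  · intro i j hij
    obtain ⟨a, b, hab⟩ := hsome i j hij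
    have e0 := ent i j a b hab
    have hne : a ≠ b := by
      rintro rfl
      apply hd1 i j hij
      rw [← e0]; simp
    set α := F (jtE i j) a b with hα
    set β := F (jtE i j) b a with hβ
    have hN : F (jtE i j) = α • jtE a b + β • jtE b a := by
      ext p q
      simp only [Matrix.add_apply, Matrix.smul_apply, jtE_apply, smul_eq_mul]
      by_cases h1 : a = p ∧ b = q
      · obtain ⟨rfl, rfl⟩ := h1
        simp [hne, hα]
      by_cases h2 : b = p ∧ a = q
      · obtain ⟨rfl, rfl⟩ := h2
        simp [hne, hβ]
      rw [if_neg h1, if_neg h2]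
      by_contra hc
      have hc2 : F (jtE i j) p q ≠ 0 := by simpa using hc
      have e1 := ent i j p q hc2
      have hpq : p ≠ q := by
        rintro rfl
        apply hd1 i j hij
        rw [← e1]; simp
      rcases hμ2 _ _ _ _ hne hpq (e0.trans e1.symm) with hh | hh
      · exact h1 hh
      · exact h2 ⟨hh.2, hh.1⟩
    have hNs : F (jtE j i) = star α • jtE b a + star β • jtE a b := by
      rw [← jtE_star, h.star, hN]; simp [jtE_star]
    have hL := h.lie (jtE i j) (jtE i j) (jtE j i)
    have e2 : jtc (jtE i j) (jtc (jtE i j) (jtE j i)) = (-2 : ℂ) • jtE i j := by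
      simp [jtc, jtE_mul, hij.symm, mul_sub, sub_mul]
      rw [← sub_eq_zero]; module
    have e3 : jtc (α • jtE a b + β • jtE b a) (jtc (α • jtE a b + β • jtE b a) 
        (star α • jtE b a + star β • jtE a b)) = 
        (α * star α - β * star β) • ((-2 * α) • jtE a b + (2 * β) • jtE b a) := by
      simp only [jtc, jtE_mul, hne, hne.symm, mul_sub, sub_mul, mul_add, add_mul, smul_mul_assoc, 
        mul_smul_comm, if_true, if_false, smul_zero, add_zero, zero_add]
      module
    rw [e2, map_smul, hNs, hN, e3] at hL
    have q1 := congrFun (congrFun hL a) b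
    have q2 := congrFun (congrFun hL b) a
    simp only [Matrix.smul_apply, Matrix.add_apply, jtE_apply, smul_eq_mul, hne, hne.symm, and_self,
      if_true, if_false, mul_zero, mul_one, add_zero, zero_add, and_false, false_and] at q1 q2
    have hs : α * star α - β * star β = 1 := by
      have : (α * star α - β * star β) * (-2 * α) = 1 * (-2 * α) := by linear_combination -q1
      exact mul_right_cancel₀ (mul_ne_zero (by norm_num) hab) this
    have hβ0 : β = 0 := by
      rw [hs] at q2
      linear_combination (-1/4 : ℂ) * q2
    refine ⟨a, b, α, hne, ?_, ?_⟩
    · rw [hβ0] at hs; simpa using hs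
    · rw [hN, hβ0]; simp
  · intro i j a b hab
    have h1 := h.lie (diagonal (fun i => (d i : ℂ))) (diagonal (fun i => (d i : ℂ))) (jtE i i - jtE j j)
    have h2 : jtc (diagonal (fun i => (d i : ℂ))) (jtc (diagonal (fun i => (d i : ℂ))) 
        (jtE i i - jtE j j)) = 0 := by
      ext a b
      rw [jt_diag_lie, Matrix.sub_apply, jtE_apply, jtE_apply]
      by_cases hab : a = b
      · subst hab; simp
      · have k1 : ¬ (i = a ∧ i = b) := fun hh => hab (hh.1.symm.trans hh.2)
        have k2 : ¬ (j = a ∧ j = b) := fun hh => hab (hh.1.symm.trans hh.2)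
        simp [k1, k2]
    rw [h2, hD, map_zero] at h1
    have h3 := congrFun (congrFun h1 a) b
    rw [jt_diag_lie] at h3
    have h4 := (mul_eq_zero.1 h3.symm)
    refine h4.resolve_left ?_
    apply pow_ne_zero
    rw [sub_ne_zero]
    exact_mod_cast hμ1 a b hab
end part5


section part6
variable {n : ℕ} {F G : Matrix (Fin n) (Fin n) ℂ →ₗ[ℂ] Matrix (Fin n) (Fin n) ℂ}

theorem jtConj_undo {U : Matrix (Fin n) (Fin n) ℂ} (hU : U * Uᴴ = 1)
    (X : Matrix (Fin n) (Fin n) ℂ) : F X = U * jtConj F U X * Uᴴ := by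
  rw [jtConj_apply]
  calc F X = (U * Uᴴ) * F X * (U * Uᴴ) := by rw [hU]; simp
    _ = _ := by simp only [mul_assoc]

theorem jt_B1 (h : LTHom F) (hne : ∀ i j, i ≠ j → F (jtE i j) ≠ 0) :
    ∃ V : Matrix (Fin n) (Fin n) ℂ, V * Vᴴ = 1 ∧ Vᴴ * V = 1 ∧ LTHom (jtConj F V) ∧ JTMono (jtConj F V) := by
  have hD : (F (diagonal (fun i : Fin n => (((2:ℝ) ^ (i:ℕ) : ℝ) : ℂ)))).IsHermitian := by
    rw [Matrix.IsHermitian, ← h.star]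
    congr 1
    rw [Matrix.diagonal_conjTranspose]
    congr 1
    ext i
    simp
  obtain ⟨V, μ, h1, h2, h3⟩ := jt_diag hD
  refine ⟨V, h1, h2, jtConj_lt h h1, jt_mono_of_diag (jtConj_lt h h1) ?_ μ ?_⟩
  · intro i j hij h0
    apply hne i j hij
    rw [jtConj_undo h1, h0]; simp
  · rw [jtConj_apply, h3]
    calc Vᴴ * (V * diagonal (fun i => (μ i : ℂ)) * Vᴴ) * V
        = (Vᴴ * V) * diagonal (fun i => (μ i : ℂ)) * (Vᴴ * V) := by simp only [mul_assoc]
      _ = _ := by rw [h2]; simp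

theorem jtTr_mono (h : JTMono G) : JTMono (jtTr G) := by
  constructor
  · intro i j hij
    obtain ⟨a, b, z, hab, hz, e⟩ := h.off i j hij
    exact ⟨b, a, z, hab.symm, hz, by rw [jtTr_apply, e, Matrix.transpose_smul, jtE_transpose]⟩
  · intro i j a b hab
    rw [jtTr_apply, Matrix.transpose_apply]
    exact h.dia i j b a hab.symm

theorem jt_comb3 {a b c d e f : Fin n} (hab : a ≠ b) (hcd : c ≠ d) (hef : e ≠ f)
    (h1 : ∀ p q, p ≠ q → jtc (jtE a b) (jtc (jtE c d) (jtE e f)) p q = 0)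
    (h2 : jtc (jtE a b) (jtc (jtE c d) (jtE e f)) ≠ 0) :
    (c = b ∧ e = d ∧ f = a) ∨ (e = b ∧ f = c ∧ d = a) := by
  have key : jtc (jtE a b) (jtc (jtE c d) (jtE e f)) =
     (if d = e ∧ b = c then jtE a f else 0) - (if f = c ∧ b = e then jtE a d else 0)
     - ((if d = e ∧ f = a then jtE c b else 0) - (if f = c ∧ d = a then jtE e b else 0)) := by
    simp only [jtc, jtE_mul, mul_sub, sub_mul]
    split_ifs <;> simp_all [jtE_mul]
  rw [key] at h1 h2
  by_contra! hc
  obtain ⟨hc1, hc2⟩ := hc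
  by_cases A : d = e ∧ b = c
  · obtain ⟨rfl, rfl⟩ := A
    have hfa : f ≠ a := hc1 rfl rfl
    have := h1 a f hfa.symm
    by_cases B : f = b ∧ d = a
    · obtain ⟨rfl, rfl⟩ := B
      simp [jtE_apply, hab, hab.symm] at this
      first | done | exact absurd this (by norm_num)
    · rw [if_neg B] at this
      simp [jtE_apply, hfa, hef, hcd] at this
  rw [if_neg A] at h1 h2
  by_cases B : f = c ∧ b = e
  · obtain ⟨rfl, rfl⟩ := B
    have hda : d ≠ a := hc2 rfl rfl
    have := h1 a d hda.symm
    simp [jtE_apply, hda, hda.symm, hab, hab.symm, hcd, hcd.symm] at this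
    split_ifs at this with hh
    · obtain ⟨rfl, rfl⟩ := hh
      simp [jtE_apply] at this
      first | done | exact absurd this (by norm_num)
    · simp at this
  rw [if_neg B] at h1 h2
  by_cases C : d = e ∧ f = a
  · obtain ⟨rfl, rfl⟩ := C
    have hcb : c ≠ b := fun hh => hc1 hh rfl rfl
    have := h1 c b hcb
    simp [jtE_apply, hcb, hcb.symm, hab, hab.symm, hcd, hcd.symm, hef] at this
  rw [if_neg C] at h1 h2
  by_cases D : f = c ∧ d = a
  · obtain ⟨rfl, rfl⟩ := D
    have heb : e ≠ b := fun hh => hc2 hh rfl rfl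
    have := h1 e b heb
    simp [jtE_apply] at this
  rw [if_neg D] at h1 h2
  simp at h2

/-- unimodular -/
theorem jt_uni_ne {z : ℂ} (hz : z * star z = 1) : z ≠ 0 := by
  rintro rfl; simp at hz

theorem jt_triangle (h : LTHom G) (hm : JTMono G) {i j k : Fin n} (hij : i ≠ j) (hjk : j ≠ k)
    (hik : i ≠ k) {a b : Fin n} {z : ℂ} (hab : a ≠ b) (hz : z * star z = 1)
    (hE : G (jtE i j) = z • jtE a b) :
    ∃ (c : Fin n) (z' w : ℂ), c ≠ a ∧ c ≠ b ∧ z' * star z' = 1 ∧ w * star w = 1 ∧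
      ((G (jtE i k) = z' • jtE a c ∧ G (jtE j k) = w • jtE b c) ∨
       (G (jtE i k) = z' • jtE c b ∧ G (jtE j k) = w • jtE c a)) := by
  obtain ⟨c, d, w, hcd, hw, hE2⟩ := hm.off j k hjk
  obtain ⟨e, f, v, hef, hv, hE3⟩ := hm.off k i hik.symm
  have hL := h.lie (jtE i j) (jtE j k) (jtE k i)
  rw [jt_lie_diff hij hjk hik, hE, hE2, hE3] at hL
  simp only [jtc_smul, smul_jtc, smul_smul] at hL
  have hne : z * w * v ≠ 0 := mul_ne_zero (mul_ne_zero (jt_uni_ne hz) (jt_uni_ne hw)) (jt_uni_ne hv)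
  have hE4 : G (jtE i k) = star v • jtE f e := by
    rw [← jtE_star, h.star, hE3]; simp [jtE_star]
  have hvs : star v * star (star v) = 1 := by rw [star_star, mul_comm]; exact hv
  have := jt_comb3 hab hcd hef (fun p q hpq => by
      have := hm.dia i j p q hpq
      rw [hL, Matrix.smul_apply, smul_eq_mul] at this
      refine (mul_eq_zero.1 this).resolve_left ?_
      intro hh; apply hne; rw [← hh]; ring) (by
      intro h0
      rw [h0, smul_zero] at hL
      have h3 := h.lie (jtE i i - jtE j j) (jtE i i - jtE j j) (jtE i j)
      have h4 : jtc (jtE i i - jtE j j) (jtc (jtE i i - jtE j j) (jtE i j)) = (4:ℂ) • jtE i j := by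
        simp only [jtc, jtE_mul, hij, hij.symm, mul_sub, sub_mul, if_true, if_false, mul_zero, zero_mul]
        module
      rw [h4, hL, zero_jtc, map_smul, hE, smul_smul] at h3
      have h5 := congrFun (congrFun h3 a) b
      simp [jtE_apply, jt_uni_ne hz] at h5)
  rcases this with ⟨rfl, rfl, rfl⟩ | ⟨rfl, rfl, rfl⟩
  · exact ⟨e, star v, w, hef, hcd.symm, hvs, hw, Or.inl ⟨hE4, hE2⟩⟩
  · exact ⟨f, star v, w, hcd, hef.symm, hvs, hw, Or.inr ⟨hE4, hE2⟩⟩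
end part6


section part7
variable {n : ℕ} {F G : Matrix (Fin n) (Fin n) ℂ →ₗ[ℂ] Matrix (Fin n) (Fin n) ℂ}

theorem jt_perm_unitary (π : Fin n → Fin n) (z : Fin n → ℂ) (hπ : Function.Injective π)
    (hz : ∀ i, z i * star (z i) = 1) : ∃ U : Matrix (Fin n) (Fin n) ℂ, U * Uᴴ = 1 ∧ Uᴴ * U = 1 ∧
      ∀ i j, Uᴴ * jtE (π i) (π j) * U = (z i * star (z j)) • jtE i j := by
  have key : ∀ U : Matrix (Fin n) (Fin n) ℂ, U = Matrix.of (fun p q => if p = π q then star (z q) else 0) →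
      Uᴴ * U = 1 := by
    rintro U rfl
    ext p q
    simp only [Matrix.mul_apply, Matrix.conjTranspose_apply, Matrix.of_apply, Matrix.one_apply]
    rw [Finset.sum_eq_single (π p)]
    · simp only [if_true, star_star]
      by_cases hpq : p = q
      · subst hpq; simpa using hz p
      · rw [if_neg (fun hh => hpq (hπ hh)), if_neg hpq, mul_zero]
    · intro b _ hb; rw [if_neg hb]; simp
    · simp
  refine ⟨_, mul_eq_one_comm.1 (key _ rfl), key _ rfl, fun i j => ?_⟩
  ext p q
  simp only [Matrix.mul_apply, Matrix.conjTranspose_apply, Matrix.of_apply, jtE_apply,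
    Matrix.smul_apply, smul_eq_mul]
  rw [Finset.sum_eq_single (π j)]
  · rw [Finset.sum_eq_single (π i)]
    · simp only [hπ.eq_iff, and_self, if_true]
      by_cases h1 : i = p <;> by_cases h2 : j = q <;> simp [h1, h2]
    · intro b _ hb; rw [if_neg (fun hh : π i = b ∧ π j = π j => hb hh.1.symm)]; simp
    · simp
  · intro b _ hb
    rw [Finset.sum_eq_zero, zero_mul]
    intro c _
    rw [if_neg (fun hh : π i = c ∧ π j = b => hb hh.2.symm)]; simp
  · simp

theorem jt_row (h : LTHom G) (hm : JTMono G) {o p q a b c : Fin n} {z1 z2 : ℂ}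
    (hp : p ≠ o) (hq : q ≠ o) (hpq : p ≠ q) (hba : b ≠ a) (hca : c ≠ a) (hbc : b ≠ c)
    (hz1 : z1 * star z1 = 1) (hz2 : z2 * star z2 = 1)
    (h1 : G (jtE o p) = z1 • jtE a b) (h2 : G (jtE o q) = z2 • jtE a c) :
    ∃ U : Matrix (Fin n) (Fin n) ℂ, U * Uᴴ = 1 ∧ Uᴴ * U = 1 ∧
      (∀ j, j ≠ o → jtConj G U (jtE o j) = jtE o j) ∧
      ∀ j k, j ≠ o → k ≠ o → j ≠ k → ∃ w : ℂ, w * star w = 1 ∧ jtConj G U (jtE j k) = w • jtE j k := by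
  have hrow : ∀ k, k ≠ o → ∃ (d : Fin n) (z : ℂ), d ≠ a ∧ z * star z = 1 ∧ G (jtE o k) = z • jtE a d := by
    intro k hk
    by_cases hkp : k = p
    · subst hkp; exact ⟨b, z1, hba, hz1, h1⟩
    by_cases hkq : k = q
    · subst hkq; exact ⟨c, z2, hca, hz2, h2⟩
    obtain ⟨d, z', w, hda, hdb, hz', hw, hh | hh⟩ :=
      jt_triangle h hm hp.symm (Ne.symm hkp) (Ne.symm hk) hba.symm hz1 h1
    · exact ⟨d, z', hda, hz', hh.1⟩
    obtain ⟨d', z'', w', hda', hdb', hz'', hw', hh' | hh'⟩ :=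
      jt_triangle h hm hq.symm (Ne.symm hkq) (Ne.symm hk) hca.symm hz2 h2
    · exact ⟨d', z'', hda', hz'', hh'.1⟩
    exfalso
    have := jtE_smul_inj (jt_uni_ne hz') (hh.1.symm.trans hh'.1)
    exact hbc this.2.1
  have hall : ∀ k, ∃ (d : Fin n) (z : ℂ), z * star z = 1 ∧ (k = o → d = a ∧ z = 1) ∧ 
      (k ≠ o → d ≠ a ∧ G (jtE o k) = z • jtE a d) := by
    intro k
    by_cases hk : k = o
    · exact ⟨a, 1, by simp, fun _ => ⟨rfl, rfl⟩, fun hh => absurd hk hh⟩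
    · obtain ⟨d, z, e1, e2, e3⟩ := hrow k hk
      exact ⟨d, z, e2, fun hh => absurd hh hk, fun _ => ⟨e1, e3⟩⟩
  choose π z hz ho hno using hall
  have tri : ∀ j k, j ≠ o → k ≠ o → j ≠ k → π j ≠ π k ∧ ∃ w : ℂ, w * star w = 1 ∧ 
      G (jtE j k) = w • jtE (π j) (π k) := by
    intro j k hj hk hjk
    obtain ⟨d, z', w, hda, hdb, hz', hw, hh | hh⟩ :=
      jt_triangle h hm hj.symm hjk (Ne.symm hk) (hno j hj).1.symm (hz j) (hno j hj).2
    · have := jtE_smul_inj (jt_uni_ne hz') (hh.1.symm.trans (hno k hk).2)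
      obtain ⟨-, rfl, -⟩ := this
      exact ⟨hdb.symm, w, hw, hh.2⟩
    · have := jtE_smul_inj (jt_uni_ne hz') (hh.1.symm.trans (hno k hk).2)
      exact absurd this.1 hda
  have hinj : Function.Injective π := by
    intro j k hjk
    by_contra hne
    by_cases hj : j = o
    · have hk : k ≠ o := fun hk => hne (hj.trans hk.symm)
      exact (hno k hk).1 (hjk.symm.trans (ho j hj).1)
    by_cases hk : k = o
    · exact (hno j hj).1 (hjk.trans (ho k hk).1)
    exact (tri j k hj hk hne).1 hjk
  obtain ⟨U, hU1, hU2, hU3⟩ := jt_perm_unitary π z hinj hz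
  refine ⟨U, hU1, hU2, ?_, ?_⟩
  · intro j hj
    have := hU3 o j
    rw [(ho o rfl).1, (ho o rfl).2] at this
    rw [jtConj_apply, (hno j hj).2, Matrix.mul_smul, Matrix.smul_mul, this, smul_smul, one_mul, hz, one_smul]
  · intro j k hj hk hjk
    obtain ⟨w, hw, e⟩ := (tri j k hj hk hjk).2
    refine ⟨w * (z j * star (z k)), ?_, ?_⟩
    · simp only [star_mul, star_star]
      have e1 := hz j
      have e2 := hz k
      calc w * (z j * star (z k)) * (z k * star (z j) * star w)
          = (w * star w) * (z j * star (z j)) * (z k * star (z k)) := by ring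
        _ = 1 := by rw [hw, e1, e2]; norm_num
    · rw [jtConj_apply, e, Matrix.mul_smul, Matrix.smul_mul, hU3, smul_smul]

theorem jt_B2 (hn : 3 ≤ n) (h : LTHom G) (hm : JTMono G) :
    ∃ (o : Fin n) (U : Matrix (Fin n) (Fin n) ℂ) 
      (G' : Matrix (Fin n) (Fin n) ℂ →ₗ[ℂ] Matrix (Fin n) (Fin n) ℂ), (G' = G ∨ G' = jtTr G) ∧
      U * Uᴴ = 1 ∧ Uᴴ * U = 1 ∧
      (∀ j, j ≠ o → jtConj G' U (jtE o j) = jtE o j) ∧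
      ∀ j k, j ≠ o → k ≠ o → j ≠ k → ∃ w : ℂ, w * star w = 1 ∧ jtConj G' U (jtE j k) = w • jtE j k := by
  obtain ⟨o⟩ : Nonempty (Fin n) := ⟨⟨0, by omega⟩⟩
  obtain ⟨p, hp, -⟩ := jt_third hn o o
  obtain ⟨q, hq, hqp⟩ := jt_third hn o p
  obtain ⟨a, b, z, hab, hz, e⟩ := hm.off o p hp.symm
  obtain ⟨c, z', w, hca, hcb, hz', hw, hh | hh⟩ := jt_triangle h hm hp.symm hqp.symm hq.symm hab hz e
  · obtain ⟨U, hU⟩ := jt_row h hm hp hq hqp.symm hab.symm hca hcb.symm hz hz' e hh.1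
    exact ⟨o, U, G, Or.inl rfl, hU⟩
  · obtain ⟨U, hU⟩ := jt_row (G := jtTr G) (jtTr_lt h) (jtTr_mono hm) hp hq hqp.symm hab hcb hca.symm hz hz'
      (by rw [jtTr_apply, e, Matrix.transpose_smul, jtE_transpose])
      (by rw [jtTr_apply, hh.1, Matrix.transpose_smul, jtE_transpose])
    exact ⟨o, U, jtTr G, Or.inr rfl, hU⟩
end part7


section part8
variable {n : ℕ} {F G : Matrix (Fin n) (Fin n) ℂ →ₗ[ℂ] Matrix (Fin n) (Fin n) ℂ}

theorem jt_B3a (hn : 3 ≤ n) (h : LTHom G) {o : Fin n} (h1 : ∀ j, j ≠ o → G (jtE o j) = jtE o j)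
    (h2 : ∀ j k, j ≠ o → k ≠ o → j ≠ k → ∃ w : ℂ, w * star w = 1 ∧ G (jtE j k) = w • jtE j k) :
    ∃ w : ℂ, (w = 1 ∨ w = -1) ∧ ∀ j k, j ≠ o → k ≠ o → j ≠ k → G (jtE j k) = w • jtE j k := by
  have h1' : ∀ j, j ≠ o → G (jtE j o) = jtE j o := by
    intro j hj
    rw [← jtE_star, h.star, h1 j hj]
  have hsw : ∀ j k (w : ℂ), j ≠ o → k ≠ o → j ≠ k → w * star w = 1 → G (jtE j k) = w • jtE j k →
      (w = 1 ∨ w = -1) ∧ G (jtE k j) = w • jtE k j := by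
    intro j k w hj hk hjk hw e
    have hL := h.lie (jtE j k) (jtE k o) (jtE o j)
    rw [jt_lie_diff hjk hk hj, e, h1' k hk, h1 j hj, smul_jtc, jt_lie_diff hjk hk hj] at hL
    have hs := h.star (jtE j j - jtE k k)
    rw [Matrix.conjTranspose_sub, jtE_star, jtE_star, hL] at hs
    have h3 := congrFun (congrFun hs j) j
    simp [jtE_apply, hjk.symm] at h3
    have h3' : star w = w := h3.symm
    refine ⟨?_, ?_⟩
    · rw [h3'] at hw
      exact mul_self_eq_one_iff.1 hw
    · rw [← jtE_star, h.star, e, Matrix.conjTranspose_smul, h3']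
  have hmove : ∀ j k l (w : ℂ), j ≠ o → k ≠ o → l ≠ o → j ≠ k → j ≠ l → 
      G (jtE j k) = w • jtE j k → G (jtE j l) = w • jtE j l := by
    intro j k l w hj hk hl hjk hjl e
    by_cases hkl : k = l
    · rw [← hkl]; exact e
    have hL := h.lie (jtE j k) (jtE k o) (jtE o l)
    have e2 : jtc (jtE j k) (jtc (jtE k o) (jtE o l)) = jtE j l := by
      simp [jtc, jtE_mul, hjl.symm, Ne.symm hkl]
    rw [e2, e, h1' k hk, h1 l hl, smul_jtc, e2] at hL
    exact hL
  obtain ⟨p, hp, -⟩ := jt_third hn o o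
  obtain ⟨q, hq, hqp⟩ := jt_third hn o p
  obtain ⟨w, hw, e⟩ := h2 p q hp hq hqp.symm
  refine ⟨w, (hsw p q w hp hq hqp.symm hw e).1, ?_⟩
  intro j k hj hk hjk
  by_cases hjp : j = p
  · subst hjp
    exact hmove j q k w hj hq hk hqp.symm hjk e
  · have e3 := hmove p q j w hp hq hj hqp.symm (Ne.symm hjp) e
    have e4 := (hsw p j w hp hj (Ne.symm hjp) hw e3).2
    exact hmove j p k w hj hp hk hjp hjk e4

theorem jt_B3b {o : Fin n} {w : ℂ} (hw : w = 1 ∨ w = -1) (h : LTHom G)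
    (h1 : ∀ j, j ≠ o → G (jtE o j) = jtE o j)
    (h2 : ∀ j k, j ≠ o → k ≠ o → j ≠ k → G (jtE j k) = w • jtE j k) :
    ∃ S : Matrix (Fin n) (Fin n) ℂ, S * Sᴴ = 1 ∧ Sᴴ * S = 1 ∧
      ∀ j k, j ≠ k → jtConj G S (jtE j k) = w • jtE j k := by
  have hww : w * w = 1 := mul_self_eq_one_iff.2 hw
  have hws : star w = w := by rcases hw with rfl | rfl <;> simp
  set s : Fin n → ℂ := fun i => if i = o then w else 1 with hs
  have hss : ∀ i, s i * s i = 1 := by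
    intro i; simp only [hs]; split_ifs <;> simp [hww]
  have hst : (diagonal s)ᴴ = diagonal s := by
    rw [Matrix.diagonal_conjTranspose]
    congr 1
    ext i
    simp only [hs, Pi.star_apply]; split_ifs <;> simp only [hws, star_one]
  have hSS : diagonal s * diagonal s = 1 := by
    rw [Matrix.diagonal_mul_diagonal, ← Matrix.diagonal_one]
    congr 1; ext i; exact hss i
  refine ⟨diagonal s, by rw [hst, hSS], by rw [hst, hSS], ?_⟩
  have hconj : ∀ j k, diagonal s * jtE j k * diagonal s = (s j * s k) • jtE j k := by
    intro j k
    ext a b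
    simp only [Matrix.diagonal_mul, Matrix.mul_diagonal, Matrix.smul_apply, jtE_apply, smul_eq_mul]
    split_ifs with hh
    · rw [hh.1, hh.2]; ring
    · simp
  intro j k hjk
  rw [jtConj_apply, hst]
  by_cases hj : j = o
  · subst hj
    have hk := Ne.symm hjk
    rw [h1 k hk, hconj]
    simp [hs, hk]
  by_cases hk : k = o
  · subst hk
    have : G (jtE j k) = jtE j k := by
      rw [← jtE_star, h.star, h1 j hj]
    rw [this, hconj]
    simp [hs, hj]
  · rw [h2 j k hj hk hjk, Matrix.mul_smul, Matrix.smul_mul, hconj]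
    simp [hs, hj, hk]

theorem jt_B3c (hn : 3 ≤ n) {w : ℂ} (hw : w = 1 ∨ w = -1) (h : LTHom G)
    (h2 : ∀ j k, j ≠ k → G (jtE j k) = w • jtE j k) :
    ∃ m : ℝ, ∀ X, G X = w • X + (X.trace * (m : ℂ)) • (1 : Matrix (Fin n) (Fin n) ℂ) := by
  have hww : w * w = 1 := mul_self_eq_one_iff.2 hw
  obtain ⟨o⟩ : Nonempty (Fin n) := ⟨⟨0, by omega⟩⟩
  set K := G - w • (LinearMap.id : Matrix (Fin n) (Fin n) ℂ →ₗ[ℂ] Matrix (Fin n) (Fin n) ℂ) with hK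
  have hKa : ∀ X, K X = G X - w • X := by intro X; simp [hK]
  have hd : ∀ i j, i ≠ j → G (jtE i i - jtE j j) = w • (jtE i i - jtE j j) := by
    intro i j hij
    obtain ⟨k, hk1, hk2⟩ := jt_third hn i j
    have := h.lie (jtE i j) (jtE j k) (jtE k i)
    rw [jt_lie_diff hij hk2.symm hk1.symm, h2 _ _ hij, h2 _ _ hk2.symm, h2 _ _ hk1] at this
    simp only [smul_jtc, jtc_smul, smul_smul] at this
    rw [jt_lie_diff hij hk2.symm hk1.symm] at this
    rw [this]
    congr 1
    linear_combination w * hww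
  have hKX := jt_trace_lemma K o (fun i j hij => by rw [hKa, h2 _ _ hij, sub_self]) (fun i => by
    by_cases hi : i = o
    · rw [hi]
    · have := hd i o hi
      rw [map_sub, smul_sub] at this
      rw [hKa, hKa, sub_eq_sub_iff_sub_eq_sub]
      exact this)
  set M := K (jtE o o) with hM
  have hG : ∀ X, G X = w • X + X.trace • M := by
    intro X
    rw [← hKX, hKa]; abel
  have hG0 : ∀ X, X.trace = 0 → G X = w • X := by
    intro X hX; rw [hG, hX]; simp
  have hc : ∀ X Y, X.trace = 0 → Y.trace = 0 → jtc X (jtc Y M) = 0 := by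
    intro X Y hX hY
    have hL := h.lie X Y (jtE o o)
    have ht : (jtE (n := n) o o).trace = 1 := by simp [jtE]
    have h0 : (jtc X (jtc Y (jtE o o))).trace = 0 := by
      rw [jtc, Matrix.trace_sub, Matrix.trace_mul_comm, sub_self]
    rw [hG0 _ h0, hG0 _ hX, hG0 _ hY, hG (jtE o o), ht, one_smul] at hL
    simp only [smul_jtc, jtc_smul, jtc_add, smul_add, smul_smul] at hL
    have e1 : w * (w * w) = w := by rw [hww, mul_one]
    rw [hww] at hL
    simp only [mul_one, one_smul] at hL
    simpa using hL
  have htd : ∀ i j : Fin n, (jtE i i - jtE j j).trace = 0 := by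
    intro i j; simp [jtE]
  have hto : ∀ i j : Fin n, i ≠ j → (jtE i j).trace = 0 := by
    intro i j hij; simp [jtE, hij]
  have hleft : ∀ (i j : Fin n) (Y : Matrix (Fin n) (Fin n) ℂ) a b, 
      (jtE i j * Y) a b = if a = i then Y j b else 0 := by
    intro i j Y a b
    simp only [Matrix.mul_apply, jtE_apply]
    by_cases ha : i = a
    · subst ha; simp
    · simp [ha, Ne.symm ha]
  have hright : ∀ (i j : Fin n) (Y : Matrix (Fin n) (Fin n) ℂ) a b, 
      (Y * jtE i j) a b = if b = j then Y a i else 0 := by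
    intro i j Y a b
    simp only [Matrix.mul_apply, jtE_apply]
    by_cases ha : j = b
    · subst ha; simp
    · simp [ha, Ne.symm ha]
  have hMo : ∀ i j, i ≠ j → M i j = 0 := by
    intro i j hij
    have := hc _ _ (htd i j) (htd i j)
    have := congrFun (congrFun this i) j
    simp only [jtc, sub_mul, mul_sub, Matrix.sub_apply, mul_assoc, hleft, hright] at this
    simp [← mul_assoc, hleft, hright, hij, hij.symm] at this
    ring_nf at this
    simpa using this
  have hMd : ∀ i j, i ≠ j → M i i = M j j := by
    intro i j hij
    have := hc _ _ (hto j i hij.symm) (hto i j hij)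
    have := congrFun (congrFun this j) j
    simp only [jtc, sub_mul, mul_sub, Matrix.sub_apply, mul_assoc, hleft, hright] at this
    simp [← mul_assoc, hleft, hright, hij, hij.symm] at this
    first
    | exact sub_eq_zero.1 this
    | exact (sub_eq_zero.1 this).symm
  have hMH : Mᴴ = M := by
    have := h.star (jtE o o)
    rw [jtE_star] at this
    rw [hM, hKa, Matrix.conjTranspose_sub, ← this, Matrix.conjTranspose_smul, jtE_star]
    congr 2
    rcases hw with rfl | rfl <;> simp
  have hreal : star (M o o) = M o o := by
    have := congrFun (congrFun hMH o) o
    simpa using this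
  refine ⟨(M o o).re, fun X => ?_⟩
  rw [hG, mul_smul]
  congr 2
  have hre : (((M o o).re : ℝ) : ℂ) = M o o := Complex.conj_eq_iff_re.1 hreal
  rw [hre]
  ext a b
  rw [Matrix.smul_apply, Matrix.one_apply]
  by_cases hab : a = b
  · subst hab
    by_cases hao : a = o
    · simp [hao]
    · simp [hMd a o hao]
  · simp [hab, hMo a b hab]

/-- structure of Lie triple homs -/
theorem jt_structure (hn : 3 ≤ n) (h : LTHom F) (hne : ∀ i j, i ≠ j → F (jtE i j) ≠ 0) :
    ∃ (U : Matrix (Fin n) (Fin n) ℂ) (w : ℂ) (m : ℝ), U * Uᴴ = 1 ∧ Uᴴ * U = 1 ∧ (w = 1 ∨ w = -1) ∧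
      ((∀ X, F X = w • (U * X * Uᴴ) + (X.trace * (m : ℂ)) • (1 : Matrix (Fin n) (Fin n) ℂ)) ∨
       (∀ X, F X = w • (U * Xᵀ * Uᴴ) + (X.trace * (m : ℂ)) • (1 : Matrix (Fin n) (Fin n) ℂ))) := by
  obtain ⟨V, hV1, hV2, hL, hm⟩ := jt_B1 h hne
  obtain ⟨o, U, G', hG', hU1, hU2, r1, r2⟩ := jt_B2 hn hL hm
  have hL' : LTHom G' := by
    rcases hG' with rfl | rfl
    · exact hL
    · exact jtTr_lt hL
  have hL1 := jtConj_lt hL' hU1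
  obtain ⟨w, hw, r3⟩ := jt_B3a hn hL1 r1 r2
  obtain ⟨S, hS1, hS2, r4⟩ := jt_B3b hw hL1 r1 r3
  obtain ⟨m, r5⟩ := jt_B3c hn hw (jtConj_lt hL1 hS1) r4
  have hc : ∀ P Q : Matrix (Fin n) (Fin n) ℂ, P * Pᴴ = 1 → Q * Qᴴ = 1 → (P * Q) * (P * Q)ᴴ = 1 := by
    intro P Q hP hQ
    rw [Matrix.conjTranspose_mul, mul_assoc, ← mul_assoc Q, hQ, one_mul, hP]
  have hW := hc U S hU1 hS1
  have r6 : ∀ X, G' X = w • ((U * S) * X * (U * S)ᴴ) + (X.trace * (m : ℂ)) • 1 := by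
    intro X
    rw [jtConj_undo (F := G') hU1, jtConj_undo (F := jtConj G' U) hS1, r5]
    rw [mul_add, add_mul, Matrix.mul_smul, Matrix.smul_mul, Matrix.mul_smul, Matrix.smul_mul, mul_one S, hS1]
    rw [mul_add, add_mul, Matrix.mul_smul, Matrix.smul_mul, Matrix.mul_smul, Matrix.smul_mul, mul_one U, hU1]
    simp only [Matrix.conjTranspose_mul, mul_assoc]
  rcases hG' with rfl | rfl
  · refine ⟨V * (U * S), w, m, hc _ _ hV1 hW, mul_eq_one_comm.1 (hc _ _ hV1 hW), hw, Or.inl fun X => ?_⟩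
    rw [jtConj_undo (F := F) hV1, r6]
    rw [mul_add, add_mul, Matrix.mul_smul, Matrix.smul_mul, Matrix.mul_smul, Matrix.smul_mul, mul_one, hV1]
    simp only [Matrix.conjTranspose_mul, mul_assoc]
  · set T := ((U * S)ᴴ)ᵀ with hT
    have hTH : Tᴴ = (U * S)ᵀ := by
      rw [hT]; ext a b; simp only [Matrix.conjTranspose_apply, Matrix.transpose_apply, star_star]
    have hTT : T * Tᴴ = 1 := by
      rw [hTH, hT, ← Matrix.transpose_mul, hW, Matrix.transpose_one]
    refine ⟨V * T, w, m, hc _ _ hV1 hTT, mul_eq_one_comm.1 (hc _ _ hV1 hTT), hw, Or.inr fun X => ?_⟩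
    have r7 : jtConj F V X = w • (T * Xᵀ * Tᴴ) + (X.trace * (m : ℂ)) • 1 := by
      have := congrArg Matrix.transpose (r6 X)
      rw [jtTr_apply, Matrix.transpose_transpose] at this
      rw [this, hTH, hT]
      simp only [Matrix.transpose_add, Matrix.transpose_smul, Matrix.transpose_mul, Matrix.transpose_one, mul_assoc]
    rw [jtConj_undo (F := F) hV1, r7]
    rw [mul_add, add_mul, Matrix.mul_smul, Matrix.smul_mul, Matrix.mul_smul, Matrix.smul_mul, mul_one, hV1]
    simp only [Matrix.conjTranspose_mul, mul_assoc]
end part8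


section part9
open NormedSpace
variable {n : ℕ} {F G : Matrix (Fin n) (Fin n) ℂ →ₗ[ℂ] Matrix (Fin n) (Fin n) ℂ}

theorem jt_trace_real {H : Matrix (Fin n) (Fin n) ℂ} (hH : H.IsHermitian) :
    H.trace = ((H.trace.re : ℝ) : ℂ) := by
  refine (Complex.conj_eq_iff_re.1 ?_).symm
  have := Matrix.trace_conjTranspose H
  rw [hH] at this
  exact this.symm

theorem jt_exp_form {H U : Matrix (Fin n) (Fin n) ℂ} (hH : H.IsHermitian) (hU : U * Uᴴ = 1) (w : ℂ) (m : ℝ) :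
    exp (w • (U * H * Uᴴ) + (H.trace * (m : ℂ)) • (1 : Matrix (Fin n) (Fin n) ℂ)) = 
      (((exp H).det.re ^ m : ℝ) : ℂ) • (U * exp (w • H) * Uᴴ) := by
  have e1 : (H.trace * (m : ℂ)) • (1 : Matrix (Fin n) (Fin n) ℂ) = 
      diagonal (fun _ => ((H.trace.re * m : ℝ) : ℂ)) := by
    rw [jt_trace_real hH, Matrix.smul_one_eq_diagonal]
    congr 1; ext; push_cast; simp
  have e2 : exp ((H.trace * (m : ℂ)) • (1 : Matrix (Fin n) (Fin n) ℂ)) = 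
      (((exp H).det.re ^ m : ℝ) : ℂ) • 1 := by
    rw [e1, jt_exp_diag (fun _ => H.trace.re * m), Matrix.smul_one_eq_diagonal, jt_det_exp hH, ← Real.exp_mul]
  have e3 : w • (U * H * Uᴴ) = U * (w • H) * Uᴴ := by simp
  rw [Matrix.exp_add_of_commute _ _ ((Commute.one_right _).smul_right _), e2, e3, jt_exp_conj hU]
  simp

theorem jt_P (V : Matrix (Fin n) (Fin n) ℂ) (h1 : V * Vᴴ = 1) (h2 : Vᴴ * V = 1) :
    (∀ j, (V * jtE j j * Vᴴ).IsHermitian ∧ (V * jtE j j * Vᴴ) * (V * jtE j j * Vᴴ) = V * jtE j j * Vᴴ ∧ 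
      (V * jtE j j * Vᴴ).rank = 1) ∧
    (∀ j k, j ≠ k → (V * jtE j j * Vᴴ) * (V * jtE k k * Vᴴ) = 0) := by
  have hm : ∀ A B : Matrix (Fin n) (Fin n) ℂ, (V * A * Vᴴ) * (V * B * Vᴴ) = V * (A * B) * Vᴴ := by
    intro A B
    calc (V * A * Vᴴ) * (V * B * Vᴴ) = V * A * (Vᴴ * V) * B * Vᴴ := by simp only [mul_assoc]
      _ = _ := by rw [h2, mul_one]; simp only [mul_assoc]
  refine ⟨fun j => ⟨?_, ?_, ?_⟩, fun j k hjk => ?_⟩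
  · rw [Matrix.IsHermitian]
    simp only [Matrix.conjTranspose_mul, Matrix.conjTranspose_conjTranspose, jtE_star, mul_assoc]
  · rw [hm, jtE_mul, if_pos rfl]
  · have hdV : IsUnit V.det := by
      rw [← Matrix.isUnit_iff_isUnit_det]
      exact IsUnit.of_mul_eq_one _ h1
    have hdV' : IsUnit (Vᴴ).det := by
      rw [← Matrix.isUnit_iff_isUnit_det]
      exact IsUnit.of_mul_eq_one _ h2
    rw [Matrix.rank_mul_eq_left_of_isUnit_det _ _ hdV', Matrix.rank_mul_eq_right_of_isUnit_det _ _ hdV]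
    have : jtE j j = diagonal (fun i : Fin n => if i = j then (1:ℂ) else 0) := by
      ext a b
      rw [jtE_apply, Matrix.diagonal_apply]
      by_cases hab : a = b
      · subst hab; simp [eq_comm]
      · rw [if_neg hab, if_neg]; rintro ⟨rfl, rfl⟩; exact hab rfl
    rw [this, Matrix.rank_diagonal]
    simp
  · rw [hm, jtE_mul, if_neg hjk]; simp

theorem jt_final (hn : 3 ≤ n) {φ : Matrix (Fin n) (Fin n) ℂ → Matrix (Fin n) (Fin n) ℂ} (hφ : JTHom φ) :
    ∃ (U : Matrix (Fin n) (Fin n) ℂ) (c : ℝ)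
      (P : Fin n → Matrix (Fin n) (Fin n) ℂ) (cs : Fin n → ℝ),
      U * Uᴴ = 1 ∧ Uᴴ * U = 1 ∧
      (∀ j, (P j).IsHermitian ∧ P j * P j = P j ∧ (P j).rank = 1) ∧
      (∀ j k, j ≠ k → P j * P k = 0) ∧
      ((∀ A : Matrix (Fin n) (Fin n) ℂ, A.PosDef →
          φ A = ((A.det.re ^ c : ℝ) : ℂ) • (U * A * Uᴴ)) ∨
       (∀ A : Matrix (Fin n) (Fin n) ℂ, A.PosDef →
          φ A = ((A.det.re ^ c : ℝ) : ℂ) • (U * A⁻¹ * Uᴴ)) ∨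
       (∀ A : Matrix (Fin n) (Fin n) ℂ, A.PosDef →
          φ A = ((A.det.re ^ c : ℝ) : ℂ) • (U * Aᵀ * Uᴴ)) ∨
       (∀ A : Matrix (Fin n) (Fin n) ℂ, A.PosDef →
          φ A = ((A.det.re ^ c : ℝ) : ℂ) • (U * (Aᵀ)⁻¹ * Uᴴ)) ∨
       (∀ A : Matrix (Fin n) (Fin n) ℂ, A.PosDef →
          φ A = ∑ j, ((A.det.re ^ cs j : ℝ) : ℂ) • P j)) := by
  obtain ⟨F, hF, hφF⟩ := jt_exists_F (by omega) hφ
  by_cases hne : ∀ i j, i ≠ j → F (jtE i j) ≠ 0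
  · obtain ⟨U, w, m, hU1, hU2, hw, hs⟩ := jt_structure hn hF hne
    obtain ⟨p1, p2⟩ := jt_P (1 : Matrix (Fin n) (Fin n) ℂ) (by simp) (by simp)
    refine ⟨U, m, _, fun _ => 0, hU1, hU2, p1, p2, ?_⟩
    rcases hs with hs | hs
    · have key : ∀ H, H.IsHermitian → 
          φ (exp H) = (((exp H).det.re ^ m : ℝ) : ℂ) • (U * exp (w • H) * Uᴴ) := by
        intro H hH
        rw [hφF H hH, hs, jt_exp_form hH hU1]
      rcases hw with rfl | rfl
      · left
        intro A hA
        obtain ⟨H, hH, rfl⟩ := jt_exists_log hA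
        rw [key H hH, one_smul]
      · right; left
        intro A hA
        obtain ⟨H, hH, rfl⟩ := jt_exists_log hA
        rw [key H hH, neg_one_smul, Matrix.exp_neg]
    · have key : ∀ H, H.IsHermitian → 
          φ (exp H) = (((exp H).det.re ^ m : ℝ) : ℂ) • (U * exp (w • Hᵀ) * Uᴴ) := by
        intro H hH
        have := jt_exp_form (H := Hᵀ) hH.transpose hU1 w m
        rw [Matrix.trace_transpose, Matrix.exp_transpose, Matrix.det_transpose] at this
        rw [hφF H hH, hs, this]
      rcases hw with rfl | rfl
      · right; right; left
        intro A hA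
        obtain ⟨H, hH, rfl⟩ := jt_exists_log hA
        rw [key H hH, one_smul, Matrix.exp_transpose]
      · right; right; right; left
        intro A hA
        obtain ⟨H, hH, rfl⟩ := jt_exists_log hA
        rw [key H hH, neg_one_smul, Matrix.exp_neg, Matrix.exp_transpose]
  · push Not at hne
    obtain ⟨i, j, hij, h0⟩ := hne
    have hA := jt_caseA hn hF hij h0 i
    have hM : (F (jtE i i)).IsHermitian := by
      rw [Matrix.IsHermitian, ← hF.star, jtE_star]
    obtain ⟨V, μ, h1, h2, h3⟩ := jt_diag hM
    obtain ⟨p1, p2⟩ := jt_P V h1 h2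
    refine ⟨1, 0, _, μ, by simp, by simp, p1, p2, ?_⟩
    right; right; right; right
    intro A hA'
    obtain ⟨H, hH, rfl⟩ := jt_exists_log hA'
    rw [hφF H hH, hA, h3]
    have e1 : H.trace • (V * diagonal (fun i => (μ i : ℂ)) * Vᴴ) = 
        V * diagonal (fun i => ((H.trace.re * μ i : ℝ) : ℂ)) * Vᴴ := by
      rw [← Matrix.smul_mul, ← Matrix.mul_smul, ← Matrix.diagonal_smul]
      congr 3
      ext i
      rw [Pi.smul_apply, smul_eq_mul]
      conv_lhs => rw [jt_trace_real hH]
      push_cast; rfl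
    rw [e1, jt_exp_conj h1, jt_exp_diag (fun i => H.trace.re * μ i)]
    have e2 : diagonal (fun i => ((Real.exp (H.trace.re * μ i) : ℝ) : ℂ)) = 
        ∑ j, (((exp H).det.re ^ μ j : ℝ) : ℂ) • jtE j j := by
      ext a b
      rw [Matrix.sum_apply, Matrix.diagonal_apply]
      simp only [Matrix.smul_apply, jtE_apply, smul_eq_mul, jt_det_exp hH, ← Real.exp_mul]
      rw [Finset.sum_eq_single a]
      · by_cases hab : a = b <;> simp [hab]
      · intro c _ hc; rw [if_neg (fun hh => hc hh.1), mul_zero]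
      · simp
    rw [e2, Finset.mul_sum, Finset.sum_mul]
    refine Finset.sum_congr rfl fun j _ => ?_
    rw [Matrix.mul_smul, Matrix.smul_mul]
end part9

/-- Theorem (Molnár): structure of continuous Jordan triple endomorphisms of ℙ_n, n ≥ 3. -/
theorem jordan_triple_endomorphisms_Pn (n : ℕ) (hn : 3 ≤ n)
    (φ : Matrix (Fin n) (Fin n) ℂ → Matrix (Fin n) (Fin n) ℂ)
    (hmaps : ∀ A : Matrix (Fin n) (Fin n) ℂ, A.PosDef → (φ A).PosDef)
    (hcont : ContinuousOn φ {A : Matrix (Fin n) (Fin n) ℂ | A.PosDef})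
    (hjordan : ∀ A B : Matrix (Fin n) (Fin n) ℂ, A.PosDef → B.PosDef →
      φ (A * B * A) = φ A * φ B * φ A) :
    ∃ (U : Matrix (Fin n) (Fin n) ℂ) (c : ℝ)
      (P : Fin n → Matrix (Fin n) (Fin n) ℂ) (cs : Fin n → ℝ),
      U * Uᴴ = 1 ∧ Uᴴ * U = 1 ∧
      (∀ j, (P j).IsHermitian ∧ P j * P j = P j ∧ (P j).rank = 1) ∧
      (∀ j k, j ≠ k → P j * P k = 0) ∧
      ((∀ A : Matrix (Fin n) (Fin n) ℂ, A.PosDef →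
          φ A = ((A.det.re ^ c : ℝ) : ℂ) • (U * A * Uᴴ)) ∨
       (∀ A : Matrix (Fin n) (Fin n) ℂ, A.PosDef →
          φ A = ((A.det.re ^ c : ℝ) : ℂ) • (U * A⁻¹ * Uᴴ)) ∨
       (∀ A : Matrix (Fin n) (Fin n) ℂ, A.PosDef →
          φ A = ((A.det.re ^ c : ℝ) : ℂ) • (U * Aᵀ * Uᴴ)) ∨
       (∀ A : Matrix (Fin n) (Fin n) ℂ, A.PosDef →
          φ A = ((A.det.re ^ c : ℝ) : ℂ) • (U * (Aᵀ)⁻¹ * Uᴴ)) ∨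
       (∀ A : Matrix (Fin n) (Fin n) ℂ, A.PosDef →
          φ A = ∑ j, ((A.det.re ^ cs j : ℝ) : ℂ) • P j)) := by
  exact jt_final hn ⟨hmaps, hcont, hjordan⟩
end

section
/- Let φ: ℙ_2 → ℙ_2 be a continuous Jordan triple endomorphism. Then one of the following holds: (b1) there is a unitary matrix U ∈ 𝕄_2 and a real number c such that φ(A) = (Det A)^c · U A U* for all A ∈ ℙ_2; (b2) there is a unitary matrix V ∈ 𝕄_2 and a real number d such that φ(A) = (Det A)^d · V A^{-1} V* for all A ∈ ℙ_2; (b3) there is a unitary matrix W ∈ 𝕄_2 and real numbers c_1, c_2 such that φ(A) = W · Diag[(Det A)^{c_1}, (Det A)^{c_2}] · W* for all A ∈ ℙ_2, where Diag[α, β] denotes the 2×2 diagonal matrix with diagonal entries α, β. -/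
open Matrix ComplexOrder

namespace JT

abbrev M2 := Matrix (Fin 2) (Fin 2) ℂ

def Un (W : M2) : Prop := W * Wᴴ = 1 ∧ Wᴴ * W = 1

noncomputable def dg (a b : ℝ) : M2 := diagonal ![(a : ℂ), (b : ℂ)]

lemma dg_mul (a b c d : ℝ) : dg a b * dg c d = dg (a * c) (b * d) := by
  simp only [dg, diagonal_mul_diagonal]
  congr 1; ext i; fin_cases i <;> simp

lemma dg_one : dg 1 1 = 1 := by
  simp only [dg]
  ext i j; fin_cases i <;> fin_cases j <;> simp

lemma dg_herm (a b : ℝ) : (dg a b)ᴴ = dg a b := by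
  ext i j; fin_cases i <;> fin_cases j <;> simp [dg]

lemma un_mul {U V : M2} (hU : Un U) (hV : Un V) : Un (U * V) := by
  constructor
  · rw [conjTranspose_mul, Matrix.mul_assoc, ← Matrix.mul_assoc V, hV.1, Matrix.one_mul, hU.1]
  · rw [conjTranspose_mul, Matrix.mul_assoc, ← Matrix.mul_assoc _ U, hU.2, Matrix.one_mul, hV.2]

lemma un_of {V : M2} (h : V * Vᴴ = 1) : Un V := ⟨h, mul_eq_one_comm.mp h⟩

lemma conj_mul {W : M2} (hW : Un W) (A B : M2) :
    (W * A * Wᴴ) * (W * B * Wᴴ) = W * (A * B) * Wᴴ := by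
  calc (W * A * Wᴴ) * (W * B * Wᴴ) = W * A * (Wᴴ * W) * B * Wᴴ := by noncomm_ring
    _ = _ := by rw [hW.2]; noncomm_ring

lemma conj_one {W : M2} (hW : Un W) : W * 1 * Wᴴ = 1 := by simp [hW.1]

lemma conj_inj {W : M2} (hW : Un W) {A B : M2} (h : W * A * Wᴴ = W * B * Wᴴ) : A = B := by
  have : ∀ X, Wᴴ * (W * X * Wᴴ) * W = X := by
    intro X
    calc Wᴴ * (W * X * Wᴴ) * W = (Wᴴ * W) * X * (Wᴴ * W) := by noncomm_ring
      _ = X := by simp [hW.2]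
  rw [← this A, h, this B]

lemma conj_trace {W : M2} (hW : Un W) (A : M2) : (W * A * Wᴴ).trace = A.trace := by
  rw [Matrix.trace_mul_comm, ← Matrix.mul_assoc, hW.2, Matrix.one_mul]

lemma conj_det {W : M2} (hW : Un W) (A : M2) : (W * A * Wᴴ).det = A.det := by
  rw [Matrix.det_mul_comm, ← Matrix.mul_assoc, hW.2, Matrix.one_mul]

lemma un_isUnit {W : M2} (hW : Un W) : IsUnit W :=
  ⟨⟨W, Wᴴ, hW.1, hW.2⟩, rfl⟩

lemma conj_pd {W : M2} (hW : Un W) {A : M2} : (W * A * Wᴴ).PosDef ↔ A.PosDef :=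
  Matrix.IsUnit.posDef_star_right_conjugate_iff (un_isUnit hW)

lemma dg_pd {a b : ℝ} : (dg a b).PosDef ↔ 0 < a ∧ 0 < b := by
  rw [dg, Matrix.posDef_diagonal_iff, Fin.forall_fin_two]
  simp

lemma herm_diag {H : M2} (hH : Hᴴ = H) : ∃ W a b, Un W ∧ H = W * dg a b * Wᴴ := by
  have hH' : H.IsHermitian := hH
  refine ⟨hH'.eigenvectorUnitary, hH'.eigenvalues 0, hH'.eigenvalues 1, ⟨?_, ?_⟩, ?_⟩
  · exact Unitary.mul_star_self_of_mem hH'.eigenvectorUnitary.2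
  · exact Unitary.star_mul_self_of_mem hH'.eigenvectorUnitary.2
  · conv_lhs => rw [hH'.spectral_theorem, Unitary.conjStarAlgAut_apply]
    have : (diagonal (RCLike.ofReal ∘ hH'.eigenvalues) : M2) =
      dg (hH'.eigenvalues 0) (hH'.eigenvalues 1) := by
      rw [dg]; congr 1; ext i; fin_cases i <;> rfl
    rw [this]; rfl

lemma pd_diag {A : M2} (hA : A.PosDef) : ∃ W a b, Un W ∧ 0 < a ∧ 0 < b ∧ A = W * dg a b * Wᴴ := by
  obtain ⟨W, a, b, hW, h⟩ := herm_diag hA.1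
  rw [h, conj_pd hW, dg_pd] at hA
  exact ⟨W, a, b, hW, hA.1, hA.2, h⟩

lemma pd_of {A : M2} (hA : Aᴴ = A) (ht : 0 < A.trace.re) (hd : 0 < A.det.re) : A.PosDef := by
  obtain ⟨W, a, b, hW, h⟩ := herm_diag hA
  rw [h, conj_trace hW] at ht
  rw [h, conj_det hW] at hd
  rw [h, conj_pd hW, dg_pd]
  simp [dg] at ht hd
  rcases lt_or_ge 0 a with ha | ha
  · exact ⟨ha, by by_contra hb; nlinarith⟩
  · nlinarith

lemma pd_det {A : M2} (hA : A.PosDef) : 0 < A.det.re ∧ A.det = (A.det.re : ℂ) := by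
  have := Complex.pos_iff.mp hA.det_pos
  exact ⟨this.1, by apply Complex.ext <;> simp [this.2]⟩

lemma pd_aba {A B : M2} (hA : A.PosDef) (hB : B.PosDef) : (A * B * A).PosDef := by
  have := (Matrix.IsUnit.posDef_star_right_conjugate_iff (x := B) hA.isUnit).mpr hB
  rwa [star_eq_conjTranspose, hA.1] at this

lemma pd_smul {A : M2} (hA : A.PosDef) {c : ℝ} (hc : 0 < c) : ((c : ℂ) • A).PosDef := by
  apply hA.smul
  simpa using hc

lemma pd_one : (1 : M2).PosDef := Matrix.PosDef.one

/-- commutation lemma -/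
lemma comm_of {P Q : M2} (hP : P.PosDef) (hQ : Q.PosDef)
    (h : P * (Q * Q) * P = Q * (P * P) * Q) : P * Q = Q * P := by
  obtain ⟨W, a, b, hW, ha, hb, rfl⟩ := pd_diag hP
  obtain ⟨R, hR⟩ : ∃ R, Q = W * R * Wᴴ := ⟨Wᴴ * Q * W, by
    calc Q = (W * Wᴴ) * Q * (W * Wᴴ) := by simp [hW.1]
      _ = _ := by noncomm_ring⟩
  subst hR
  have hRh := (conj_pd hW).mp hQ |>.1
  simp only [conj_mul hW] at h ⊢
  have h := conj_inj hW h
  congr 2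
  have e := congrFun (congrFun h 0) 0
  have r10 : R 1 0 = star (R 0 1) := (congrFun (congrFun hRh 1) 0).symm
  simp [dg, Matrix.mul_apply, Fin.sum_univ_two, r10] at e
  have e2 : ((a : ℂ)^2 - b^2) * (R 0 1 * star (R 0 1)) = 0 := by
    simp only [Complex.star_def]
    linear_combination e
  rcases mul_eq_zero.mp e2 with h0 | h0
  · have : a = b := by
      have : (a^2 - b^2 : ℝ) = 0 := by exact_mod_cast h0
      nlinarith
    subst this
    ext i j; fin_cases i <;> fin_cases j <;> simp [dg, mul_comm]
  · have h01 : R 0 1 = 0 := by simpa using h0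
    ext i j; fin_cases i <;> fin_cases j <;> simp [dg, Matrix.mul_apply, Fin.sum_univ_two, h01, r10, mul_comm]

/-- simultaneous diagonalization against a nonscalar Hermitian matrix -/
lemma simdiag {H : M2} (hH : Hᴴ = H) (hns : ∀ c : ℝ, H ≠ (c : ℂ) • 1) :
    ∃ W, Un W ∧ ∀ M : M2, Mᴴ = M → M * H = H * M → ∃ a b, M = W * dg a b * Wᴴ := by
  obtain ⟨W, a, b, hW, rfl⟩ := herm_diag hH
  have hab : a ≠ b := by
    rintro rfl
    apply hns a
    have : dg a a = (a : ℂ) • (1 : M2) := by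
      ext i j; fin_cases i <;> fin_cases j <;> simp [dg]
    rw [this]; simp [hW.1]
  refine ⟨W, hW, ?_⟩
  intro M hM hc
  obtain ⟨R, hR⟩ : ∃ R, M = W * R * Wᴴ := ⟨Wᴴ * M * W, by
    calc M = (W * Wᴴ) * M * (W * Wᴴ) := by simp [hW.1]
      _ = _ := by noncomm_ring⟩
  subst hR
  simp only [conj_mul hW] at hc
  have hc := conj_inj hW hc
  have hRh : Rᴴ = R := by
    apply conj_inj hW
    conv_rhs => rw [← hM]
    simp [Matrix.mul_assoc]
  have hne : ((a : ℂ) - b) ≠ 0 := by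
    rw [sub_ne_zero]; exact_mod_cast hab
  have e := congrFun (congrFun hc 0) 1
  simp [dg, Matrix.mul_apply, Fin.sum_univ_two] at e
  have h01 : R 0 1 = 0 := by
    have : ((a : ℂ) - b) * R 0 1 = 0 := by linear_combination -e
    simpa [hne] using this
  have r10 : R 1 0 = star (R 0 1) := (congrFun (congrFun hRh 1) 0).symm
  have r00 : ((R 0 0).re : ℂ) = R 0 0 := Complex.conj_eq_iff_re.mp (congrFun (congrFun hRh 0) 0)
  have r11 : ((R 1 1).re : ℂ) = R 1 1 := Complex.conj_eq_iff_re.mp (congrFun (congrFun hRh 1) 1)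
  refine ⟨(R 0 0).re, (R 1 1).re, ?_⟩
  congr 2
  ext i j; fin_cases i <;> fin_cases j <;> simp [dg, h01, r10, r00, r11]

lemma cauchy {m : ℝ → ℝ} (hp : ∀ s, 0 < m s) (hc : Continuous m)
    (hm : ∀ s t, m (s + t) = m s * m t) : ∃ r : ℝ, ∀ s, m s = Real.exp (r * s) := by
  let g : ℝ →+ ℝ := AddMonoidHom.mk' (fun s => Real.log (m s)) (by
    intro s t
    simp only [hm]
    exact Real.log_mul (hp s).ne' (hp t).ne')
  have hg : Continuous g := hc.log (fun s => (hp s).ne')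
  refine ⟨g 1, fun s => ?_⟩
  have : g s = s • g 1 := by
    have := (g.toRealLinearMap hg).map_smul s 1
    simpa using this
  rw [smul_eq_mul, mul_comm] at this
  rw [← this]
  exact (Real.exp_log (hp s)).symm
end JT

namespace JT

structure IsU (X : M2) : Prop where
  herm : Xᴴ = X
  sq : X * X = 1
  tr : X.trace = 0

noncomputable def Z : M2 := dg 1 (-1)
def Sx : M2 := !![0, 1; 1, 0]
def Sy : M2 := !![0, -Complex.I; Complex.I, 0]

lemma dg_eq (a b : ℝ) : dg a b = !![(a : ℂ), 0; 0, (b : ℂ)] := by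
  ext i j; fin_cases i <;> fin_cases j <;> simp [dg]

lemma Sx_swap (a b : ℝ) : Sx * dg a b * Sx = dg b a := by
  rw [dg_eq, dg_eq, Sx]
  ext i j; fin_cases i <;> fin_cases j <;> simp [Matrix.mul_apply, Fin.sum_univ_two]

lemma isU_Z : IsU Z := by
  refine ⟨dg_herm _ _, ?_, ?_⟩
  · rw [Z, dg_mul, ← dg_one]; norm_num
  · simp [Z, dg]

lemma isU_Sx : IsU Sx := by
  refine ⟨?_, ?_, ?_⟩
  · ext i j; fin_cases i <;> fin_cases j <;> simp [Sx]
  · ext i j; fin_cases i <;> fin_cases j <;> simp [Sx]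
  · simp [Sx, Matrix.trace_fin_two]

lemma isU_Sy : IsU Sy := by
  refine ⟨?_, ?_, ?_⟩
  · ext i j; fin_cases i <;> fin_cases j <;> simp [Sy]
  · ext i j; fin_cases i <;> fin_cases j <;> simp [Sy]
  · simp [Sy, Matrix.trace_fin_two]

lemma IsU.un {X : M2} (h : IsU X) : Un X := ⟨by rw [h.herm, h.sq], by rw [h.herm, h.sq]⟩

lemma IsU.neg {X : M2} (h : IsU X) : IsU (-X) :=
  ⟨by rw [conjTranspose_neg, h.herm], by simp [h.sq], by simp [h.tr]⟩

lemma IsU.conj {X W : M2} (h : IsU X) (hW : Un W) : IsU (W * X * Wᴴ) :=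
  ⟨by simp [Matrix.mul_assoc, h.herm], by rw [JT.conj_mul hW, h.sq, conj_one hW],
    by rw [conj_trace hW, h.tr]⟩

lemma IsU.form {X : M2} (h : IsU X) : ∃ (p : ℝ) (q : ℂ), X = !![(p : ℂ), q; star q, -(p : ℂ)] ∧
    (p : ℂ)^2 + q * star q = 1 := by
  have r10 : X 1 0 = star (X 0 1) := (congrFun (congrFun h.herm 1) 0).symm
  have r00 : ((X 0 0).re : ℂ) = X 0 0 := Complex.conj_eq_iff_re.mp (congrFun (congrFun h.herm 0) 0)
  have ht := h.tr
  rw [Matrix.trace_fin_two] at ht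
  have e := congrFun (congrFun h.sq 0) 0
  rw [Matrix.mul_apply, Fin.sum_univ_two, r10] at e
  refine ⟨(X 0 0).re, X 0 1, ?_, ?_⟩
  · ext i j; fin_cases i <;> fin_cases j
    · simp [r00]
    · simp
    · simpa using r10
    · simp [r00]; linear_combination ht
  · rw [r00]; simpa [pow_two] using e

lemma isU_of {p : ℝ} {q : ℂ} (h : (p : ℂ)^2 + q * star q = 1) :
    IsU !![(p : ℂ), q; star q, -(p : ℂ)] := by
  simp only [Complex.star_def] at h
  refine ⟨?_, ?_, ?_⟩
  · ext i j; fin_cases i <;> fin_cases j <;> simp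
  · ext i j; fin_cases i <;> fin_cases j <;> simp <;> first | (ring; done) | linear_combination h
  · simp [Matrix.trace_fin_two]

lemma IsU.diag {X : M2} (h : IsU X) : ∃ W, Un W ∧ X = W * Z * Wᴴ := by
  obtain ⟨W, a, b, hW, rfl⟩ := herm_diag h.herm
  have h1 := h.tr
  rw [conj_trace hW] at h1
  have h2 := h.sq
  rw [JT.conj_mul hW, ← conj_one hW] at h2
  have h2 := conj_inj hW h2
  have e := congrFun (congrFun h2 0) 0
  simp [dg] at e
  simp [dg] at h1
  have h1 : a + b = 0 := by exact_mod_cast h1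
  have e : a * a = 1 := by exact_mod_cast e
  have hb : b = -a := by linarith
  subst hb
  rcases mul_self_eq_one_iff.mp e with rfl | rfl
  · exact ⟨W, hW, rfl⟩
  · refine ⟨W * Sx, un_mul hW isU_Sx.un, ?_⟩
    rw [conjTranspose_mul, isU_Sx.herm]
    have : dg (-1) (- -1) = Sx * Z * Sx := by
      rw [Z, Sx_swap]; norm_num
    rw [this]; noncomm_ring

def qm (p0 pz px : ℝ) : M2 := !![(p0 : ℂ), pz - Complex.I * px; pz + Complex.I * px, p0]

lemma qm_pd {p0 pz px : ℝ} (h0 : 0 < p0) (h : pz^2 + px^2 < p0^2) : (qm p0 pz px).PosDef := by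
  apply pd_of
  · ext i j; fin_cases i <;> fin_cases j <;> simp [qm] <;> ring
  · simp [qm, Matrix.trace_fin_two]; linarith
  · simp [qm, Matrix.det_fin_two]; nlinarith

lemma iZ_prod : Complex.I • Z = qm (13/12) (-3/4) (-2/3) * qm (65/2) (51/2) 20 *
    qm 13 (-11) (-6) * qm (13/24) (11/24) 0 := by
  have hI := Complex.I_sq
  have hI3 : Complex.I^3 = - Complex.I := by rw [pow_succ, hI]; ring
  ext i j; fin_cases i <;> fin_cases j <;>
    simp [dg, Z, qm, Matrix.mul_apply, Fin.sum_univ_two] <;> ring_nf <;> simp only [hI, hI3] <;> ring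

lemma four {S : M2} (h : IsU S) : ∃ P₁ P₂ P₃ P₄ : M2, P₁.PosDef ∧ P₂.PosDef ∧ P₃.PosDef ∧ P₄.PosDef ∧
    Complex.I • S = P₁ * P₂ * P₃ * P₄ := by
  obtain ⟨W, hW, rfl⟩ := h.diag
  refine ⟨W * qm (13/12) (-3/4) (-2/3) * Wᴴ, W * qm (65/2) (51/2) 20 * Wᴴ, W * qm 13 (-11) (-6) * Wᴴ,
    W * qm (13/24) (11/24) 0 * Wᴴ, ?_, ?_, ?_, ?_, ?_⟩
  iterate 4 exact (conj_pd hW).mpr (qm_pd (by norm_num) (by norm_num))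
  rw [JT.conj_mul hW, JT.conj_mul hW, JT.conj_mul hW, ← iZ_prod]
  simp

/-- a four-fold product acts by congruence -/
lemma four_conj {S : M2} (h : IsU S) : ∃ P₁ P₂ P₃ P₄ : M2, P₁.PosDef ∧ P₂.PosDef ∧ P₃.PosDef ∧ P₄.PosDef ∧
    ∀ B : M2, S * B * S = P₁ * (P₂ * (P₃ * (P₄ * B * P₄) * P₃) * P₂) * P₁ := by
  obtain ⟨P₁, P₂, P₃, P₄, h1, h2, h3, h4, e⟩ := four h
  refine ⟨P₁, P₂, P₃, P₄, h1, h2, h3, h4, fun B => ?_⟩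
  have e' : (-Complex.I) • S = P₄ * P₃ * P₂ * P₁ := by
    have := congrArg conjTranspose e
    simp only [conjTranspose_mul, conjTranspose_smul, h.herm, h1.1.eq, h2.1.eq, h3.1.eq, h4.1.eq] at this
    simpa [Matrix.mul_assoc] using this
  calc S * B * S = (Complex.I • S) * B * ((-Complex.I) • S) := by
        simp [smul_smul]
    _ = _ := by rw [e, e']; noncomm_ring

lemma scalarD {f : M2 → ℝ} (hp : ∀ A : M2, A.PosDef → 0 < f A)
    (hc : ContinuousOn f {A : M2 | A.PosDef})
    (hj : ∀ A B : M2, A.PosDef → B.PosDef → f (A * B * A) = f A * f B * f A) :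
    ∃ c : ℝ, ∀ A : M2, A.PosDef → f A = A.det.re ^ c := by
  have f1 : f 1 = 1 := by
    have h := hj 1 1 pd_one pd_one
    simp only [Matrix.mul_one] at h
    have h0 := hp 1 pd_one
    have : f 1 * (f 1 * f 1 - 1) = 0 := by linarith
    rcases mul_eq_zero.mp this with h | h
    · linarith
    · nlinarith
  have hdg : ∀ s : ℝ, (dg (Real.exp s) (Real.exp s)).PosDef := fun s =>
    dg_pd.mpr ⟨Real.exp_pos _, Real.exp_pos _⟩
  have hsq : ∀ A : M2, A.PosDef → f (A * A) = f A * f A := by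
    intro A hA
    have := hj A 1 hA pd_one
    simpa [f1] using this
  obtain ⟨k, hk⟩ := cauchy (m := fun s => f (dg (Real.exp s) (Real.exp s))) (fun s => hp _ (hdg s))
    (by
      apply hc.comp_continuous _ hdg
      unfold dg
      apply Continuous.matrix_diagonal
      apply continuous_pi
      intro i; fin_cases i <;> simp <;> fun_prop)
    (by
      intro s t
      have := hj _ _ (hdg (s/2)) (hdg t)
      have h2 := hsq _ (hdg (s/2))
      simp only [dg_mul, ← Real.exp_add, add_halves] at this h2
      rw [show s / 2 + t + s / 2 = s + t by ring] at this
      simp only [this, h2]; ring)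
  refine ⟨k / 2, fun A hA => ?_⟩
  obtain ⟨W, a, b, hW, ha, hb, rfl⟩ := pd_diag hA
  rw [conj_det hW]
  have hd : (dg a b).det.re = a * b := by simp [dg]
  rw [hd]
  obtain ⟨P₁, P₂, P₃, P₄, h1, h2, h3, h4, e⟩ := four_conj (isU_Sx.conj hW)
  have key : ∀ B : M2, B.PosDef → f ((W * Sx * Wᴴ) * B * (W * Sx * Wᴴ)) = f B := by
    have h : ∀ B : M2, B.PosDef → f ((W * Sx * Wᴴ) * B * (W * Sx * Wᴴ)) =
        f B * (f P₁ * f P₂ * f P₃ * f P₄)^2 := by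
      intro B hB
      have k4 := pd_aba h4 hB
      have k3 := pd_aba h3 k4
      have k2 := pd_aba h2 k3
      rw [e, hj _ _ h1 k2, hj _ _ h2 k3, hj _ _ h3 k4, hj _ _ h4 hB]
      ring
    have h0 := h 1 pd_one
    rw [Matrix.mul_one, (isU_Sx.conj hW).sq, f1, one_mul] at h0
    intro B hB
    rw [h B hB, ← h0, mul_one]
  have hab : (W * dg a b * Wᴴ).PosDef := hA
  have hsw : f (W * dg b a * Wᴴ) = f (W * dg a b * Wᴴ) := by
    rw [← key _ hA, JT.conj_mul hW, JT.conj_mul hW]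
    rw [Sx_swap]
  have hr : (W * dg (√a) (√b) * Wᴴ).PosDef :=
    (conj_pd hW).mpr (dg_pd.mpr ⟨Real.sqrt_pos.mpr ha, Real.sqrt_pos.mpr hb⟩)
  have q1 := hsq _ hr
  have q2 := hj _ (W * dg b a * Wᴴ) hr ((conj_pd hW).mpr (dg_pd.mpr ⟨hb, ha⟩))
  simp only [JT.conj_mul hW, dg_mul, Real.mul_self_sqrt ha.le, Real.mul_self_sqrt hb.le] at q1 q2
  rw [hsw, show √a * b * √a = a * b by rw [mul_right_comm, Real.mul_self_sqrt ha.le],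
    show √b * a * √b = a * b by rw [mul_right_comm, Real.mul_self_sqrt hb.le, mul_comm]] at q2
  have hpos : 0 < a * b := mul_pos ha hb
  have q3 : W * dg (a * b) (a * b) * Wᴴ = dg (a * b) (a * b) := by
    have : dg (a * b) (a * b) = ((a * b : ℝ) : ℂ) • (1 : M2) := by
      ext i j; fin_cases i <;> fin_cases j <;> simp [dg]
    rw [this]; simp [hW.1]
  have q4 := hk (Real.log (a * b))
  simp only [Real.exp_log hpos] at q4
  rw [q3, q4] at q2
  have q5 : f (W * dg a b * Wᴴ) * f (W * dg a b * Wᴴ) = (a * b) ^ (k/2) * (a * b) ^ (k/2) := by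
    rw [← Real.rpow_add hpos, add_halves, Real.rpow_def_of_pos hpos, mul_comm _ k, q2]
    nth_rw 1 [q1]; ring
  exact (mul_self_inj (hp _ hA).le (Real.rpow_nonneg hpos.le _)).mp q5

end JT

namespace JT

open Filter Topology in
lemma r_one {r : ℝ} (hr : 0 < r)
    (h : ∀ a c, Real.cosh c = Real.cosh a * Real.cosh a →
      Real.cosh (r * c) = Real.cosh (r * a) * Real.cosh (r * a)) : r = 1 := by
  let F : ℝ → ℝ := fun x => Real.cosh x * Real.exp (-x)
  have hF : Tendsto F atTop (𝓝 (1/2)) := by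
    have h1 : F = fun x => (1 + Real.exp (-(2 * x))) / 2 := by
      ext x
      simp only [F, Real.cosh_eq]
      have e1 : Real.exp x * Real.exp (-x) = 1 := by rw [← Real.exp_add]; simp
      have e2 : Real.exp (-(2*x)) = Real.exp (-x) * Real.exp (-x) := by
        rw [← Real.exp_add]; ring_nf
      rw [e2]; linear_combination e1 / 2
    rw [h1]
    have : Tendsto (fun x : ℝ => Real.exp (-(2 * x))) atTop (𝓝 0) :=
      Real.tendsto_exp_neg_atTop_nhds_zero.comp (tendsto_id.const_mul_atTop (by norm_num))
    simpa using (this.const_add 1).div_const 2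
  have hcF : ∀ x, Real.cosh x = F x * Real.exp x := by
    intro x
    simp only [F, mul_assoc]; rw [← Real.exp_add]; simp
  have hFp : ∀ x, 0 < F x := fun x => mul_pos (Real.cosh_pos x) (Real.exp_pos _)
  have hex : ∀ a : ℝ, ∃ c, 0 ≤ c ∧ Real.cosh c = Real.cosh a * Real.cosh a := by
    intro a
    have : 1 ≤ Real.cosh a * Real.cosh a := by nlinarith [Real.one_le_cosh a]
    exact ⟨Real.arcosh _, Real.arcosh_nonneg this, Real.cosh_arcosh this⟩
  choose c hc0 hc using hex
  have hct : Tendsto c atTop atTop := by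
    apply tendsto_atTop_mono' _ _ tendsto_id
    filter_upwards [eventually_ge_atTop 0] with a ha
    have : Real.cosh a ≤ Real.cosh (c a) := by rw [hc]; nlinarith [Real.one_le_cosh a]
    rw [Real.cosh_le_cosh, abs_of_nonneg ha, abs_of_nonneg (hc0 a)] at this
    exact this
  have gen : ∀ k : ℝ, (0 < k) → (∀ a, Real.cosh (k * c a) = Real.cosh (k * a) * Real.cosh (k * a)) →
      Tendsto (fun a => Real.exp (k * (c a - 2 * a))) atTop (𝓝 (1/2)) := by
    intro k hk hh
    have e : (fun a => Real.exp (k * (c a - 2 * a))) = fun a => F (k * a) * F (k * a) / F (k * c a) := by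
      ext a
      rw [eq_div_iff (hFp _).ne']
      have := hh a
      rw [hcF, hcF (k * a)] at this
      rw [show k * (c a - 2 * a) = k * c a + (-(k * a) + -(k * a)) by ring, Real.exp_add, Real.exp_add]
      have e1 : Real.exp (k * a) * Real.exp (-(k * a)) = 1 := by rw [← Real.exp_add]; simp
      calc _ = (F (k * c a) * Real.exp (k * c a)) * (Real.exp (-(k * a)) * Real.exp (-(k * a))) := by ring
        _ = F (k * a) * F (k * a) * (Real.exp (k * a) * Real.exp (-(k * a)))^2 := by rw [this]; ring
        _ = _ := by rw [e1]; ring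
    rw [e]
    have t1 := hF.comp (tendsto_id.const_mul_atTop hk)
    have t2 := hF.comp (hct.const_mul_atTop hk)
    have := (t1.mul t1).div t2 (by norm_num)
    norm_num at this
    norm_num
    exact this
  have g1 := gen 1 one_pos (by intro a; simpa using hc a)
  have g2 := gen r hr (fun a => h _ _ (hc a))
  have g3 := g1.rpow_const (p := r) (Or.inl (by norm_num))
  have e : (fun a => Real.exp (1 * (c a - 2 * a)) ^ r) = fun a => Real.exp (r * (c a - 2 * a)) := by
    ext a
    rw [← Real.exp_mul]; ring_nf
  rw [e] at g3
  have := tendsto_nhds_unique g2 g3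
  have h2 : Real.log (1/2) = r * Real.log (1/2) := by
    conv_lhs => rw [this]
    rw [Real.log_rpow (by norm_num)]
  have h3 : Real.log (1/2) < 0 := Real.log_neg (by norm_num) (by norm_num)
  have : (r - 1) * Real.log (1/2) = 0 := by linarith
  rcases mul_eq_zero.mp this with h | h
  · linarith
  · linarith

noncomputable def E (s : ℝ) (X : M2) : M2 := (Real.cosh s : ℂ) • 1 + (Real.sinh s : ℂ) • X

lemma E_add {X : M2} (h : IsU X) (s t : ℝ) : E s X * E t X = E (s + t) X := by
  simp only [E, Real.cosh_add, Real.sinh_add, Complex.ofReal_add, Complex.ofReal_mul,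
    Matrix.add_mul, Matrix.mul_add, Matrix.smul_mul, Matrix.mul_smul, h.sq, Matrix.one_mul, Matrix.mul_one]
  module

lemma E_neg (s : ℝ) (X : M2) : E s (-X) = E (-s) X := by simp [E]

lemma E_zero (X : M2) : E 0 X = 1 := by simp [E]

lemma E_conj {W : M2} (hW : Un W) (s : ℝ) (X : M2) : W * E s X * Wᴴ = E s (W * X * Wᴴ) := by
  simp [E, Matrix.mul_add, Matrix.add_mul, hW.1]

lemma E_trace {X : M2} (h : IsU X) (s : ℝ) : (E s X).trace = 2 * (Real.cosh s : ℂ) := by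
  simp only [E, Matrix.trace_add, Matrix.trace_smul, h.tr, Matrix.trace_one]
  simp [mul_comm]

lemma E_Z (s : ℝ) : E s Z = dg (Real.exp s) (Real.exp (-s)) := by
  rw [← Real.cosh_add_sinh, ← Real.cosh_sub_sinh, dg_eq, Z, dg_eq]
  ext i j; fin_cases i <;> fin_cases j <;> simp [E, sub_eq_add_neg]

lemma E_pd {X : M2} (h : IsU X) (s : ℝ) : (E s X).PosDef := by
  obtain ⟨W, hW, rfl⟩ := h.diag
  rw [← E_conj hW, conj_pd hW, E_Z, dg_pd]
  exact ⟨Real.exp_pos _, Real.exp_pos _⟩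

lemma E_surj {A : M2} (hA : A.PosDef) (hd : A.det = 1) : ∃ s X, IsU X ∧ A = E s X := by
  obtain ⟨W, a, b, hW, ha, hb, rfl⟩ := pd_diag hA
  rw [conj_det hW] at hd
  have hab : a * b = 1 := by
    simp [dg] at hd; exact_mod_cast hd
  refine ⟨Real.log a, W * Z * Wᴴ, isU_Z.conj hW, ?_⟩
  rw [← E_conj hW, E_Z, Real.exp_neg, Real.exp_log ha, eq_inv_of_mul_eq_one_right hab]

lemma E_inj {s : ℝ} (hs : s ≠ 0) {X Y : M2} (h : E s X = E s Y) : X = Y := by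
  simp only [E, add_right_inj] at h
  have : (Real.sinh s : ℂ) ≠ 0 := by
    exact_mod_cast (Real.sinh_eq_zero.not.mpr hs)
  exact smul_right_injective _ this h

lemma E_trace_mul {X Y : M2} (hX : IsU X) (hY : IsU Y) (s t : ℝ) : (E s X * E t Y).trace =
    2 * (Real.cosh s * Real.cosh t : ℝ) + (Real.sinh s * Real.sinh t : ℝ) * (X * Y).trace := by
  simp only [E, Matrix.add_mul, Matrix.mul_add, Matrix.smul_mul, Matrix.mul_smul,
    Matrix.one_mul, Matrix.mul_one, Matrix.trace_add, Matrix.trace_smul, hX.tr, hY.tr, Matrix.trace_one]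
  simp
  ring

lemma cont_E (X : M2) : Continuous (fun s => E s X) := by
  unfold E
  have h1 : Continuous fun s : ℝ => ((Real.cosh s : ℝ) : ℂ) :=
    Complex.continuous_ofReal.comp Real.continuous_cosh
  have h2 : Continuous fun s : ℝ => ((Real.sinh s : ℝ) : ℂ) :=
    Complex.continuous_ofReal.comp Real.continuous_sinh
  exact (h1.smul continuous_const).add (h2.smul continuous_const)

lemma transit {X : M2} (h : IsU X) : X = -Z ∨ ∃ S, IsU S ∧ S * Z * S = X := by
  obtain ⟨p, q, rfl, hpq⟩ := h.form
  have hr : p^2 + Complex.normSq q = 1 := by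
    rw [Complex.star_def, Complex.mul_conj] at hpq
    exact_mod_cast hpq
  have hnq := Complex.normSq_nonneg q
  by_cases hp : p = -1
  · left
    subst hp
    have : q = 0 := by
      apply Complex.normSq_eq_zero.mp; linarith
    subst this
    rw [Z, dg_eq]
    ext i j; fin_cases i <;> fin_cases j <;> simp
  · right
    have hp1 : 0 < 2 + 2 * p := by
      have : -1 ≤ p := by nlinarith
      have := lt_of_le_of_ne this (Ne.symm hp)
      linarith
    obtain ⟨n, hn, hn2⟩ : ∃ n : ℝ, 0 < n ∧ n * n = 2 + 2 * p :=
      ⟨√(2+2*p), Real.sqrt_pos.mpr hp1, Real.mul_self_sqrt hp1.le⟩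
    have hnC : (n : ℂ) ≠ 0 := by exact_mod_cast hn.ne'
    have hn2C : (n : ℂ) * n = 2 + 2 * p := by exact_mod_cast hn2
    simp only [Complex.star_def] at hpq
    refine ⟨!![(((p + 1)/n : ℝ) : ℂ), q / n; star (q / n), -(((p + 1)/n : ℝ) : ℂ)], isU_of ?_, ?_⟩
    · simp
      field_simp
      linear_combination hpq - hn2C
    · rw [Z, dg_eq]
      ext i j; fin_cases i <;> fin_cases j <;> simp [Matrix.mul_apply, Fin.sum_univ_two] <;> field_simp
      · linear_combination (-1)* hpq - p * hn2C
      · linear_combination (-q) * hn2C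
      · linear_combination (-(starRingEnd ℂ) q) * hn2C
      · linear_combination  hpq + p * hn2C

end JT

namespace JT

structure JE (ψ : M2 → M2) : Prop where
  pd : ∀ A : M2, A.PosDef → (ψ A).PosDef
  det : ∀ A : M2, A.PosDef → (ψ A).det = 1
  cont : ContinuousOn ψ {A : M2 | A.PosDef}
  j : ∀ A B : M2, A.PosDef → B.PosDef → ψ (A * B * A) = ψ A * ψ B * ψ A

lemma jordan_one {ψ : M2 → M2} (pd : ∀ A : M2, A.PosDef → (ψ A).PosDef)
    (j : ∀ A B : M2, A.PosDef → B.PosDef → ψ (A * B * A) = ψ A * ψ B * ψ A) : ψ 1 = 1 := by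
  have h := j 1 1 pd_one pd_one
  simp only [Matrix.mul_one] at h
  obtain ⟨W, a, b, hW, ha, hb, e⟩ := pd_diag (pd 1 pd_one)
  rw [e] at h ⊢
  rw [JT.conj_mul hW, JT.conj_mul hW] at h
  have h := conj_inj hW h
  rw [dg_mul, dg_mul, dg_eq, dg_eq] at h
  have h0 := congrFun (congrFun h 0) 0
  have h1 := congrFun (congrFun h 1) 1
  simp at h0 h1
  have h0 : a = a * a * a := by exact_mod_cast h0
  have h1 : b = b * b * b := by exact_mod_cast h1
  have key : ∀ x : ℝ, 0 < x → x = x * x * x → x = 1 := by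
    intro x hx hh
    have : x * ((x - 1) * (x + 1)) = 0 := by linarith
    have h2 := (mul_eq_zero.mp this).resolve_left hx.ne'
    rcases mul_eq_zero.mp h2 with h | h <;> linarith
  rw [key a ha h0, key b hb h1, dg_one, conj_one hW]

lemma jordan_sq {ψ : M2 → M2} (pd : ∀ A : M2, A.PosDef → (ψ A).PosDef)
    (j : ∀ A B : M2, A.PosDef → B.PosDef → ψ (A * B * A) = ψ A * ψ B * ψ A) {A : M2} (hA : A.PosDef) :
    ψ (A * A) = ψ A * ψ A := by
  have := j A 1 hA pd_one
  simpa [jordan_one pd j] using this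

/-- commutativity is preserved, for squares -/
lemma jordan_comm {ψ : M2 → M2} (pd : ∀ A : M2, A.PosDef → (ψ A).PosDef)
    (j : ∀ A B : M2, A.PosDef → B.PosDef → ψ (A * B * A) = ψ A * ψ B * ψ A) {A B : M2}
    (hA : A.PosDef) (hB : B.PosDef) (h : A * B = B * A) : ψ A * ψ B = ψ B * ψ A := by
  apply comm_of (pd A hA) (pd B hB)
  have sq : ∀ {A : M2}, A.PosDef → (A * A).PosDef := by
    intro A hA
    simpa using pd_aba hA pd_one
  rw [← jordan_sq pd j hB, ← jordan_sq pd j hA, ← j _ _ hA (sq hB), ← j _ _ hB (sq hA)]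
  congr 1
  calc A * (B * B) * A = (A * B) * (B * A) := by noncomm_ring
    _ = (B * A) * (A * B) := by rw [h]
    _ = _ := by noncomm_ring

lemma JE.rot {ψ : M2 → M2} (h : JE ψ) {S : M2} (hS : IsU S) : ∃ V, Un V ∧ ∀ B : M2, B.PosDef →
    ψ (S * B * S) = V * ψ B * Vᴴ := by
  obtain ⟨P₁, P₂, P₃, P₄, h1, h2, h3, h4, e⟩ := four_conj hS
  have key : ∀ B : M2, B.PosDef →
    ψ (S * B * S) = (ψ P₁ * ψ P₂ * ψ P₃ * ψ P₄) * ψ B * (ψ P₁ * ψ P₂ * ψ P₃ * ψ P₄)ᴴ := by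
    intro B hB
    have k4 := pd_aba h4 hB
    have k3 := pd_aba h3 k4
    have k2 := pd_aba h2 k3
    rw [e, h.j _ _ h1 k2, h.j _ _ h2 k3, h.j _ _ h3 k4, h.j _ _ h4 hB]
    simp only [conjTranspose_mul, (h.pd _ h1).1.eq, (h.pd _ h2).1.eq, (h.pd _ h3).1.eq,
      (h.pd _ h4).1.eq]
    noncomm_ring
  refine ⟨_, un_of ?_, key⟩
  have := key 1 pd_one
  rw [Matrix.mul_one, hS.sq, jordan_one h.pd h.j, Matrix.mul_one] at this
  exact this.symm

lemma JE.curve {ψ : M2 → M2} (h : JE ψ) : ∃ (r : ℝ) (Y : M2), IsU Y ∧ ∀ s, ψ (E s Z) = E (r * s) Y := by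
  have hE := fun s => E_pd isU_Z s
  have hM := fun s => h.pd _ (hE s)
  by_cases hs : ∀ s, ∃ c : ℝ, ψ (E s Z) = (c : ℂ) • 1
  · refine ⟨0, Z, isU_Z, fun s => ?_⟩
    obtain ⟨c, hc⟩ := hs s
    have hd := h.det _ (hE s)
    have hp := (hM s).trace_pos
    rw [hc] at hd hp ⊢
    simp at hd hp
    have hc1 : c = 1 := by
      rcases hd with hd | hd
      · exact_mod_cast hd
      · have : c = -1 := by exact_mod_cast hd
        linarith
    simp [hc1, E_zero]
  · push Not at hs
    obtain ⟨s0, hs0⟩ := hs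
    obtain ⟨W, hW, hall⟩ := simdiag (hM s0).1 hs0
    have hcomm : ∀ s t, ψ (E s Z) * ψ (E t Z) = ψ (E t Z) * ψ (E s Z) := by
      intro s t
      apply jordan_comm h.pd h.j (hE s) (hE t)
      rw [E_add isU_Z, E_add isU_Z, add_comm]
    have hab := fun s => hall _ (hM s).1 (hcomm s s0)
    choose a b hab using hab
    have hpos : ∀ s, 0 < a s ∧ 0 < b s := by
      intro s
      have := hM s
      rwa [hab, conj_pd hW, dg_pd] at this
    have hmul : ∀ s t, a (s + t) = a s * a t := by
      intro s t
      have e1 : ψ (E (s + t) Z) = ψ (E s Z) * ψ (E t Z) := by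
        have e2 := jordan_sq h.pd h.j (hE (s/2))
        have e3 := h.j _ _ (hE (s/2)) (hE t)
        rw [E_add isU_Z, add_halves] at e2
        rw [E_add isU_Z, E_add isU_Z, show s/2+t+s/2 = s + t by ring] at e3
        rw [e3, e2, Matrix.mul_assoc, hcomm t, Matrix.mul_assoc]
      rw [hab, hab, hab, JT.conj_mul hW, dg_mul] at e1
      have e2 := congrFun (congrFun (conj_inj hW e1) 0) 0
      simp [dg] at e2
      exact_mod_cast e2
    have hcont : Continuous a := by
      have e : a = fun s => ((Wᴴ * ψ (E s Z) * W) 0 0).re := by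
        ext s
        have : Wᴴ * ψ (E s Z) * W = dg (a s) (b s) := by
          rw [hab]
          calc _ = (Wᴴ * W) * dg (a s) (b s) * (Wᴴ * W) := by noncomm_ring
            _ = _ := by simp [hW.2]
        rw [this]; simp [dg]
      rw [e]
      have c1 : Continuous fun s => ψ (E s Z) := h.cont.comp_continuous (cont_E Z) hE
      have c2 : Continuous fun s => Wᴴ * ψ (E s Z) * W :=
        (continuous_const.matrix_mul c1).matrix_mul continuous_const
      exact Complex.continuous_re.comp (c2.matrix_elem 0 0)
    obtain ⟨r, hr⟩ := cauchy (fun s => (hpos s).1) hcont hmul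
    refine ⟨r, W * Z * Wᴴ, isU_Z.conj hW, fun s => ?_⟩
    have hd := h.det _ (hE s)
    rw [hab, conj_det hW] at hd
    have hd : a s * b s = 1 := by
      simp [dg] at hd; exact_mod_cast hd
    rw [hab, ← E_conj hW, E_Z, Real.exp_neg, ← hr, eq_inv_of_mul_eq_one_right hd]

lemma JE.map {ψ : M2 → M2} (h : JE ψ) : ∃ (r : ℝ) (f : M2 → M2), 0 ≤ r ∧
    ∀ X, IsU X → IsU (f X) ∧ ∀ s, ψ (E s X) = E (r * s) (f X) := by
  have main : ∃ r : ℝ, ∀ X, ∃ Y, IsU X → IsU Y ∧ ∀ s, ψ (E s X) = E (r * s) Y := by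
    obtain ⟨r, Y, hY, hr⟩ := h.curve
    refine ⟨r, fun X => ?_⟩
    by_cases hX : IsU X
    · rcases transit hX with rfl | ⟨S, hS, rfl⟩
      · refine ⟨-Y, fun _ => ⟨hY.neg, fun s => ?_⟩⟩
        rw [E_neg, E_neg, hr]; ring_nf
      · obtain ⟨V, hV, hVB⟩ := h.rot hS
        refine ⟨V * Y * Vᴴ, fun _ => ⟨hY.conj hV, fun s => ?_⟩⟩
        have : E s (S * Z * S) = S * E s Z * S := by
          have := E_conj hS.un s Z
          rw [hS.herm] at this
          exact this.symm
        rw [this, hVB _ (E_pd isU_Z s), hr, E_conj hV]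
    · exact ⟨X, fun h => absurd h hX⟩
  obtain ⟨r, hr⟩ := main
  choose f hf using hr
  rcases le_total 0 r with h0 | h0
  · exact ⟨r, f, h0, fun X hX => hf X hX⟩
  · refine ⟨-r, fun X => -f X, by linarith, fun X hX => ⟨(hf X hX).1.neg, fun s => ?_⟩⟩
    rw [E_neg, (hf X hX).2]; ring_nf

lemma JE.trace_rel {ψ : M2 → M2} (h : JE ψ) {r : ℝ} {f : M2 → M2}
    (hf : ∀ X, IsU X → IsU (f X) ∧ ∀ s, ψ (E s X) = E (r * s) (f X)) {X Y : M2} (hX : IsU X) (hY : IsU Y)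
    (a b : ℝ) : ∃ c : ℝ, 2 * (Real.cosh c : ℂ) = 2 * (Real.cosh a * Real.cosh b : ℝ) +
      (Real.sinh a * Real.sinh b : ℝ) * (X * Y).trace ∧
      2 * (Real.cosh (r * c) : ℂ) = 2 * (Real.cosh (r * a) * Real.cosh (r * b) : ℝ) +
      (Real.sinh (r * a) * Real.sinh (r * b) : ℝ) * (f X * f Y).trace := by
  have hA := E_pd hX (a/2)
  have hB := E_pd hY b
  have cyc : ∀ A B : M2, (A * B * A).trace = (A * A * B).trace := by
    intro A B
    rw [Matrix.trace_mul_comm, Matrix.mul_assoc]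
  have detE : ∀ {X : M2}, IsU X → ∀ s, (E s X).det = 1 := by
    intro X hX s
    obtain ⟨W, hW, rfl⟩ := hX.diag
    rw [← E_conj hW, conj_det hW, E_Z]
    simp [dg, ← Complex.exp_add]
  obtain ⟨c, T, hT, e⟩ := E_surj (pd_aba hA hB) (by simp [Matrix.det_mul, detE hX, detE hY])
  refine ⟨c, ?_, ?_⟩
  · rw [← E_trace hT, ← e, cyc, E_add hX, add_halves, E_trace_mul hX hY]
  · have e2 := h.j _ _ hA hB
    rw [e, (hf T hT).2, (hf X hX).2, (hf Y hY).2] at e2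
    rw [← E_trace (hf T hT).1, e2, cyc, E_add (hf X hX).1, ← mul_add, add_halves,
      E_trace_mul (hf X hX).1 (hf Y hY).1]

lemma tr_ZSx : (Z * Sx).trace = 0 := by
  rw [Z, dg_eq, Sx]; simp [Matrix.trace_fin_two]

lemma JE.orth {ψ : M2 → M2} (h : JE ψ) {r : ℝ} (hr : 0 < r) {f : M2 → M2}
    (hf : ∀ X, IsU X → IsU (f X) ∧ ∀ s, ψ (E s X) = E (r * s) (f X)) : (f Z * f Sx).trace = 0 := by
  obtain ⟨V, hV, hVB⟩ := h.rot isU_Z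
  have hr1 : r * 1 ≠ 0 := by simpa using hr.ne'
  have e1 : V * f Z * Vᴴ = f Z := by
    have := hVB _ (E_pd isU_Z 1)
    have e : Z * E 1 Z * Z = E 1 Z := by
      have := E_conj isU_Z.un 1 Z
      rw [isU_Z.herm] at this
      rw [this, isU_Z.sq, Matrix.one_mul]
    rw [e, (hf Z isU_Z).2, E_conj hV] at this
    exact (E_inj hr1 this).symm
  have e2 : V * f Sx * Vᴴ = - f Sx := by
    have := hVB _ (E_pd isU_Sx 1)
    have e : Z * E 1 Sx * Z = E (-1) Sx := by
      have := E_conj isU_Z.un 1 Sx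
      rw [isU_Z.herm] at this
      rw [this, ← E_neg]
      congr 1
      rw [Z, dg_eq, Sx]
      ext i j; fin_cases i <;> fin_cases j <;> simp
    rw [e, (hf Sx isU_Sx).2, (hf Sx isU_Sx).2, E_conj hV, show r * -1 = -(r * 1) by ring, ← E_neg] at this
    exact (E_inj hr1 this).symm
  have := conj_trace hV (f Z * f Sx)
  rw [← JT.conj_mul hV, e1, e2] at this
  simp only [Matrix.mul_neg, Matrix.trace_neg] at this
  linear_combination (-1/2) * this

lemma JE.r_eq {ψ : M2 → M2} (h : JE ψ) {r : ℝ} (hr : 0 < r) {f : M2 → M2}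
    (hf : ∀ X, IsU X → IsU (f X) ∧ ∀ s, ψ (E s X) = E (r * s) (f X)) : r = 1 := by
  apply r_one hr
  intro a c hc
  obtain ⟨c', h1, h2⟩ := h.trace_rel hf isU_Z isU_Sx a a
  rw [tr_ZSx, mul_zero, add_zero] at h1
  rw [h.orth hr hf, mul_zero, add_zero] at h2
  have h1 : 2 * Real.cosh c' = 2 * (Real.cosh a * Real.cosh a) := by exact_mod_cast h1
  have h2 : 2 * Real.cosh (r * c') = 2 * (Real.cosh (r * a) * Real.cosh (r * a)) := by exact_mod_cast h2
  have h3 : Real.cosh c = Real.cosh c' := by linarith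
  have h4 : |c| = |c'| := le_antisymm (Real.cosh_le_cosh.mp h3.le) (Real.cosh_le_cosh.mp h3.ge)
  have h5 : Real.cosh (r * c) = Real.cosh (r * c') := by
    rw [← Real.cosh_abs, abs_mul, h4, ← abs_mul, Real.cosh_abs]
  linarith

lemma JE.tr_pres {ψ : M2 → M2} (h : JE ψ) {f : M2 → M2}
    (hf : ∀ X, IsU X → IsU (f X) ∧ ∀ s, ψ (E s X) = E s (f X)) {X Y : M2} (hX : IsU X) (hY : IsU Y) :
    (f X * f Y).trace = (X * Y).trace := by
  obtain ⟨c, h1, h2⟩ := h.trace_rel (r := 1) (by simpa using hf) hX hY 1 1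
  simp only [one_mul] at h2
  rw [h1] at h2
  have h3 := add_left_cancel h2
  have : ((Real.sinh 1 * Real.sinh 1 : ℝ) : ℂ) ≠ 0 := by
    have : Real.sinh 1 ≠ 0 := Real.sinh_eq_zero.not.mpr one_ne_zero
    exact_mod_cast mul_ne_zero this this
  exact (mul_left_cancel₀ this h3).symm

lemma classify {f : M2 → M2} (hf : ∀ X, IsU X → IsU (f X))
    (ht : ∀ X Y, IsU X → IsU Y → (f X * f Y).trace = (X * Y).trace) :
    ∃ U, Un U ∧ ((∀ X, IsU X → f X = U * X * Uᴴ) ∨ (∀ X, IsU X → f X = U * Xᵀ * Uᴴ)) := by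
  have back : ∀ {W : M2}, Un W → ∀ A, W * (Wᴴ * A * W) * Wᴴ = A := by
    intro W hW A
    calc _ = (W * Wᴴ) * A * (W * Wᴴ) := by noncomm_ring
      _ = _ := by simp [hW.1]
  have unc : ∀ {W : M2}, Un W → Un Wᴴ := fun h => ⟨by simpa using h.2, by simpa using h.1⟩
  have tz : ∀ (p : ℂ) (q q' : ℂ), (!![p, q; q', -p] * Z).trace = 2 * p := by
    intro p q q'
    rw [Z, dg_eq]; simp [Matrix.trace_fin_two]; ring
  have tx : ∀ (p : ℂ) (q q' : ℂ), (!![p, q; q', -p] * Sx).trace = q + q' := by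
    intro p q q'
    rw [Sx]; simp [Matrix.trace_fin_two]
  have ty : ∀ (p : ℂ) (q q' : ℂ), (!![p, q; q', -p] * Sy).trace = Complex.I * (q - q') := by
    intro p q q'
    rw [Sy]; simp [Matrix.trace_fin_two]; ring
  -- the basis is fixed after conjugation
  obtain ⟨U, hU, hUZ, hUX⟩ : ∃ U, Un U ∧ f Z = U * Z * Uᴴ ∧ f Sx = U * Sx * Uᴴ := by
    obtain ⟨W, hW, hZ⟩ := (hf Z isU_Z).diag
    have hg := (hf Sx isU_Sx).conj (unc hW)
    rw [conjTranspose_conjTranspose] at hg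
    obtain ⟨p, q, e, hpq⟩ := hg.form
    have e' : f Sx = W * !![(p : ℂ), q; star q, -(p : ℂ)] * Wᴴ := by rw [← e, back hW]
    have h0 := ht Sx Z isU_Sx isU_Z
    rw [e', hZ, JT.conj_mul hW, conj_trace hW, tz, Matrix.trace_mul_comm, tr_ZSx] at h0
    have hp : (p : ℂ) = 0 := by linear_combination h0 / 2
    rw [hp] at e' hpq
    have hpq' : q * (starRingEnd ℂ) q = 1 := by simpa using hpq
    have hD : Un !![q, 0; 0, 1] := by
      apply un_of
      ext i j; fin_cases i <;> fin_cases j <;> simp [Matrix.mul_apply, Fin.sum_univ_two, hpq']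
    refine ⟨W * !![q, 0; 0, 1], un_mul hW hD, ?_, ?_⟩
    · rw [hZ, conjTranspose_mul]
      have : Z = !![q, 0; 0, 1] * Z * !![q, 0; 0, 1]ᴴ := by
        rw [Z, dg_eq]
        ext i j; fin_cases i <;> fin_cases j <;> simp [Matrix.mul_apply, Fin.sum_univ_two, hpq']
      conv_lhs => rw [this]
      noncomm_ring
    · rw [e', conjTranspose_mul]
      have : !![(0 : ℂ), q; star q, -0] = !![q, 0; 0, 1] * Sx * !![q, 0; 0, 1]ᴴ := by
        rw [Sx]
        ext i j; fin_cases i <;> fin_cases j <;> simp [Matrix.mul_apply, Fin.sum_univ_two]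
      rw [this]
      noncomm_ring
  refine ⟨U, hU, ?_⟩
  have frm : ∀ X, IsU X → ∃ (p : ℝ) (q : ℂ), f X = U * !![(p : ℂ), q; star q, -(p : ℂ)] * Uᴴ ∧
      (p : ℂ)^2 + q * star q = 1 := by
    intro X hX
    have hg := (hf X hX).conj (unc hU)
    rw [conjTranspose_conjTranspose] at hg
    obtain ⟨p, q, e, hpq⟩ := hg.form
    exact ⟨p, q, by rw [← e, back hU], hpq⟩
  obtain ⟨p, q, eY, hpq⟩ := frm Sy isU_Sy
  have hSy : (Sy : M2) = !![(0:ℂ), -Complex.I; Complex.I, -0] := by simp [Sy]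
  have y1 := ht Sy Z isU_Sy isU_Z
  rw [eY, hUZ, JT.conj_mul hU, conj_trace hU, tz, hSy, tz] at y1
  have y2 := ht Sy Sx isU_Sy isU_Sx
  rw [eY, hUX, JT.conj_mul hU, conj_trace hU, tx, hSy, tx] at y2
  have hp : (p : ℂ) = 0 := by linear_combination y1 / 2
  have hq : star q = -q := by linear_combination y2
  have hq2 : q = -Complex.I ∨ q = Complex.I := by
    rw [hp, hq] at hpq
    have : (q + Complex.I) * (q - Complex.I) = 0 := by
      linear_combination -hpq - Complex.I_sq
    rcases mul_eq_zero.mp this with h | h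
    · left; linear_combination h
    · right; linear_combination h
  have main : ∀ ε : ℂ, f Sy = U * (ε • Sy) * Uᴴ → ∀ X, IsU X → ∃ (p : ℝ) (q q' : ℂ),
      X = !![(p : ℂ), q; star q, -(p : ℂ)] ∧ f X = U * !![(p : ℂ), q'; star q', -(p : ℂ)] * Uᴴ ∧
      q' + star q' = q + star q ∧ ε * (q' - star q') = q - star q := by
    intro ε hε X hX
    obtain ⟨p, q, e, -⟩ := hX.form
    obtain ⟨p', q', e', -⟩ := frm X hX
    have k1 := ht X Z hX isU_Z
    rw [e', hUZ, JT.conj_mul hU, conj_trace hU, tz, e, tz] at k1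
    have k2 := ht X Sx hX isU_Sx
    rw [e', hUX, JT.conj_mul hU, conj_trace hU, tx, e, tx] at k2
    have k3 := ht X Sy hX isU_Sy
    rw [e', hε, JT.conj_mul hU, conj_trace hU, Matrix.mul_smul, Matrix.trace_smul, ty, e, ty,
      smul_eq_mul] at k3
    have hp : (p' : ℂ) = p := by linear_combination k1 / 2
    rw [hp] at e'
    refine ⟨p, q, q', e, e', k2, ?_⟩
    apply mul_left_cancel₀ Complex.I_ne_zero
    linear_combination k3
  rcases hq2 with hq2 | hq2
  · left
    intro X hX
    obtain ⟨p, q, q', rfl, e', h1, h2⟩ := main 1 (by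
      rw [eY, hp, hq2, hSy]; simp) X hX
    have : q' = q := by linear_combination (h1 + h2) / 2
    rw [e', this]
  · right
    intro X hX
    obtain ⟨p, q, q', rfl, e', h1, h2⟩ := main (-1) (by
      rw [eY, hp, hq2, hSy]; simp) X hX
    have : q' = star q := by linear_combination (h1 - h2) / 2
    rw [e', this]
    congr 2
    ext i j; fin_cases i <;> fin_cases j <;> simp

lemma JE.final {ψ : M2 → M2} (h : JE ψ) :
    (∀ A : M2, A.PosDef → A.det = 1 → ψ A = 1) ∨
    ∃ U, Un U ∧ ((∀ A : M2, A.PosDef → A.det = 1 → ψ A = U * A * Uᴴ) ∨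
      (∀ A : M2, A.PosDef → A.det = 1 → ψ A = U * Aᵀ * Uᴴ)) := by
  obtain ⟨r, f, hr0, hf⟩ := h.map
  rcases hr0.eq_or_lt with h0 | h0
  · left
    intro A hA hd
    obtain ⟨s, X, hX, rfl⟩ := E_surj hA hd
    rw [(hf X hX).2, ← h0, zero_mul, E_zero]
  · right
    have := h.r_eq h0 hf
    subst this
    simp only [one_mul] at hf
    obtain ⟨U, hU, h1⟩ := classify (fun X hX => (hf X hX).1) (fun X Y hX hY => h.tr_pres hf hX hY)
    refine ⟨U, hU, ?_⟩
    rcases h1 with h1 | h1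
    · left
      intro A hA hd
      obtain ⟨s, X, hX, rfl⟩ := E_surj hA hd
      rw [(hf X hX).2, h1 X hX, E_conj hU]
    · right
      intro A hA hd
      obtain ⟨s, X, hX, rfl⟩ := E_surj hA hd
      rw [(hf X hX).2, h1 X hX, ← E_conj hU]
      simp [E]

end JT

namespace JT

lemma cont_entry {φ : M2 → M2} (hcont : ContinuousOn φ {A : M2 | A.PosDef}) (W : M2) (i : Fin 2) :
    ContinuousOn (fun A => ((Wᴴ * φ A * W) i i).re) {A : M2 | A.PosDef} := by
  have hg : Continuous fun M : M2 => ((Wᴴ * M * W) i i).re :=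
    Complex.continuous_re.comp
      (((continuous_const.matrix_mul continuous_id).matrix_mul continuous_const).matrix_elem i i)
  exact hg.comp_continuousOn hcont

lemma case_diag {φ : M2 → M2} (hmaps : ∀ A : M2, A.PosDef → (φ A).PosDef)
    (hcont : ContinuousOn φ {A : M2 | A.PosDef})
    (hj : ∀ A B : M2, A.PosDef → B.PosDef → φ (A * B * A) = φ A * φ B * φ A)
    {W : M2} (hW : Un W) (hall : ∀ A : M2, A.PosDef → ∃ a b : ℝ, φ A = W * dg a b * Wᴴ) :
    ∃ c₁ c₂ : ℝ, ∀ A : M2, A.PosDef → φ A = W * dg (A.det.re ^ c₁) (A.det.re ^ c₂) * Wᴴ := by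
  let g : Fin 2 → M2 → ℝ := fun i A => ((Wᴴ * φ A * W) i i).re
  have hg : ∀ A : M2, A.PosDef → φ A = W * dg (g 0 A) (g 1 A) * Wᴴ := by
    intro A hA
    obtain ⟨a, b, h⟩ := hall A hA
    have : Wᴴ * φ A * W = dg a b := by
      rw [h]
      calc _ = (Wᴴ * W) * dg a b * (Wᴴ * W) := by noncomm_ring
        _ = _ := by simp [hW.2]
    simp only [g, this]
    rw [h]; simp [dg]
  have hpos : ∀ A : M2, A.PosDef → 0 < g 0 A ∧ 0 < g 1 A := by
    intro A hA
    have := hmaps A hA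
    rwa [hg A hA, conj_pd hW, dg_pd] at this
  have hmul : ∀ A B : M2, A.PosDef → B.PosDef → g 0 (A * B * A) = g 0 A * g 0 B * g 0 A ∧
      g 1 (A * B * A) = g 1 A * g 1 B * g 1 A := by
    intro A B hA hB
    have h := hj A B hA hB
    rw [hg _ (pd_aba hA hB), hg A hA, hg B hB, JT.conj_mul hW, JT.conj_mul hW, dg_mul, dg_mul] at h
    have h := conj_inj hW h
    have h0 := congrFun (congrFun h 0) 0
    have h1 := congrFun (congrFun h 1) 1
    simp [dg] at h0 h1
    exact ⟨by exact_mod_cast h0, by exact_mod_cast h1⟩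
  obtain ⟨c₁, h1⟩ := scalarD (f := g 0) (fun A hA => (hpos A hA).1) (cont_entry hcont W 0)
    (fun A B hA hB => (hmul A B hA hB).1)
  obtain ⟨c₂, h2⟩ := scalarD (f := g 1) (fun A hA => (hpos A hA).2) (cont_entry hcont W 1)
    (fun A B hA hB => (hmul A B hA hB).2)
  refine ⟨c₁, c₂, fun A hA => ?_⟩
  rw [hg A hA, h1 A hA, h2 A hA]

lemma transpose_inv {A : M2} (hd : A.det ≠ 0) : Aᵀ = A.det • (Sy * A⁻¹ * Sy) := by
  rw [Matrix.inv_def, Matrix.mul_smul, Matrix.smul_mul, smul_smul, Ring.inverse_eq_inv',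
    mul_inv_cancel₀ hd, one_smul, Matrix.adjugate_fin_two, Sy]
  ext i j; fin_cases i <;> fin_cases j <;> simp
  all_goals ring_nf
  all_goals simp

lemma case_scalar {φ : M2 → M2} (hmaps : ∀ A : M2, A.PosDef → (φ A).PosDef)
    (hcont : ContinuousOn φ {A : M2 | A.PosDef})
    (hj : ∀ A B : M2, A.PosDef → B.PosDef → φ (A * B * A) = φ A * φ B * φ A)
    (hs : ∀ l : ℝ, 0 < l → ∃ k : ℝ, φ ((l : ℂ) • 1) = (k : ℂ) • 1) :
    ∃ c : ℝ, (∀ A : M2, A.PosDef → φ A = ((A.det.re ^ c : ℝ) : ℂ) • 1) ∨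
    ∃ U, Un U ∧ ((∀ A : M2, A.PosDef → φ A = ((A.det.re ^ c : ℝ) : ℂ) • (U * A * Uᴴ)) ∨
      (∀ A : M2, A.PosDef → φ A = ((A.det.re ^ c : ℝ) : ℂ) • (U * A⁻¹ * Uᴴ))) := by
  have hdm : ∀ A B : M2, A.PosDef → B.PosDef → (A * B * A).det.re = A.det.re * B.det.re * A.det.re := by
    intro A B hA hB
    rw [Matrix.det_mul, Matrix.det_mul, (pd_det hA).2, (pd_det hB).2]
    simp
  obtain ⟨c, hc⟩ := scalarD (f := fun A => (φ A).det.re) (fun A hA => (pd_det (hmaps A hA)).1)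
    ((Complex.continuous_re.comp (continuous_id.matrix_det)).comp_continuousOn hcont)
    (by
      intro A B hA hB
      simp only [hj A B hA hB]
      exact hdm _ _ (hmaps A hA) (hmaps B hB))
  let ψ : M2 → M2 := fun A => ((A.det.re ^ (-(c/2)) : ℝ) : ℂ) • φ A
  have hψ : JE ψ := by
    refine ⟨?_, ?_, ?_, ?_⟩
    · intro A hA
      exact pd_smul (hmaps A hA) (Real.rpow_pos_of_pos (pd_det hA).1 _)
    · intro A hA
      simp only [ψ, Matrix.det_smul, Fintype.card_fin]
      rw [(pd_det (hmaps A hA)).2, hc A hA]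
      have : (A.det.re ^ (-(c/2)))^2 * A.det.re ^ c = 1 := by
        rw [← Real.rpow_natCast, ← Real.rpow_mul (pd_det hA).1.le, ← Real.rpow_add (pd_det hA).1]
        norm_num
      exact_mod_cast this
    · have h1 : ContinuousOn (fun A : M2 => ((A.det.re ^ (-(c/2)) : ℝ) : ℂ)) {A : M2 | A.PosDef} := by
        apply Complex.continuous_ofReal.comp_continuousOn
        apply ContinuousOn.rpow_const
        · exact (Complex.continuous_re.comp (continuous_id.matrix_det)).continuousOn
        · intro A hA
          exact Or.inl (pd_det hA).1.ne'
      exact h1.smul hcont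
    · intro A B hA hB
      have pA := (pd_det hA).1
      have pB := (pd_det hB).1
      simp only [ψ, hj A B hA hB, hdm A B hA hB]
      rw [Real.mul_rpow (mul_pos pA pB).le pA.le, Real.mul_rpow pA.le pB.le]
      simp only [Matrix.smul_mul, Matrix.mul_smul, smul_smul, Complex.ofReal_mul]
      congr 1; ring
  have hψ1 : ∀ A : M2, A.det = 1 → ψ A = φ A := by
    intro A hA
    simp [ψ, hA]
  have red : ∀ A : M2, A.PosDef → ∃ B : M2, B.PosDef ∧ B.det = 1 ∧
      B = ((A.det.re ^ (-(1/2) : ℝ) : ℝ) : ℂ) • A ∧ φ A = ((A.det.re ^ (c/2) : ℝ) : ℂ) • ψ B := by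
    intro A hA
    obtain ⟨hd, hdd⟩ := pd_det hA
    set d := A.det.re with hdef
    have hBpd := pd_smul hA (Real.rpow_pos_of_pos hd (-(1/2)))
    have hBdet : (((d ^ (-(1/2) : ℝ) : ℝ) : ℂ) • A).det = 1 := by
      rw [Matrix.det_smul, hdd, Fintype.card_fin]
      have : (d ^ (-(1/2) : ℝ))^2 * d = 1 := by
        rw [← Real.rpow_natCast, ← Real.rpow_mul hd.le]
        norm_num
        rw [Real.rpow_neg_one, inv_mul_cancel₀ hd.ne']
      exact_mod_cast this
    refine ⟨_, hBpd, hBdet, rfl, ?_⟩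
    rw [hψ1 _ hBdet]
    obtain ⟨k, hk⟩ := hs (d ^ (1/4 : ℝ)) (Real.rpow_pos_of_pos hd _)
    have e := hj _ _ (pd_smul pd_one (Real.rpow_pos_of_pos hd (1/4))) hBpd
    have e1 : ((d ^ (1/4 : ℝ) : ℝ) : ℂ) • (1 : M2) * (((d ^ (-(1/2) : ℝ) : ℝ) : ℂ) • A) *
        ((d ^ (1/4 : ℝ) : ℝ) : ℂ) • (1 : M2) = A := by
      simp only [Matrix.smul_mul, Matrix.mul_smul, smul_smul, Matrix.one_mul, Matrix.mul_one]
      have : d ^ (1/4 : ℝ) * (d ^ (1/4 : ℝ) * d ^ (-(1/2) : ℝ)) = 1 := by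
        rw [← Real.rpow_add hd, ← Real.rpow_add hd]; norm_num
      rw [← Complex.ofReal_mul, ← Complex.ofReal_mul]
      rw [mul_comm (d ^ (-(1/2) : ℝ)), this]; simp
    rw [e1, hk] at e
    have e2 : φ A = ((k * k : ℝ) : ℂ) • φ (((d ^ (-(1/2) : ℝ) : ℝ) : ℂ) • A) := by
      rw [e]
      simp only [Matrix.smul_mul, Matrix.mul_smul, smul_smul, Matrix.one_mul, Matrix.mul_one,
        Complex.ofReal_mul]
    have h1 := hc A hA
    have h2 := hc _ hBpd
    simp only [hBdet, Complex.one_re, Real.one_rpow] at h2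
    rw [e2, Matrix.det_smul, (pd_det (hmaps _ hBpd)).2, h2, Fintype.card_fin] at h1
    have h3 : (k * k) * (k * k) = d ^ c := by
      have : ((((k * k : ℝ) : ℂ) ^ 2 * ((1 : ℝ) : ℂ))).re = (k * k) * (k * k) := by
        rw [← Complex.ofReal_pow, ← Complex.ofReal_mul, Complex.ofReal_re]; ring
      rw [← this]; exact h1
    have h4 : k * k = d ^ (c/2) := by
      apply (mul_self_inj (mul_self_nonneg k) (Real.rpow_nonneg hd.le _)).mp
      rw [h3, ← Real.rpow_add hd, add_halves]
    rw [e2, h4]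
  rcases hψ.final with h | ⟨U, hU, h | h⟩
  · refine ⟨c/2, Or.inl fun A hA => ?_⟩
    obtain ⟨B, hB, hBd, -, e⟩ := red A hA
    rw [e, h B hB hBd]
  · refine ⟨c/2 + -(1/2), Or.inr ⟨U, hU, Or.inl fun A hA => ?_⟩⟩
    obtain ⟨B, hB, hBd, hBA, e⟩ := red A hA
    rw [e, h B hB hBd, Real.rpow_add (pd_det hA).1, hBA]
    simp only [Matrix.mul_smul, Matrix.smul_mul, smul_smul, Complex.ofReal_mul]
  · refine ⟨c/2 + -(1/2) + 1, Or.inr ⟨U * Sy, un_mul hU isU_Sy.un, Or.inr fun A hA => ?_⟩⟩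
    obtain ⟨B, hB, hBd, hBA, e⟩ := red A hA
    have hdd := pd_det hA
    have hne : A.det ≠ 0 := by rw [hdd.2]; exact_mod_cast hdd.1.ne'
    rw [e, h B hB hBd, Real.rpow_add hdd.1, Real.rpow_add hdd.1, Real.rpow_one, hBA,
      Matrix.transpose_smul, transpose_inv hne, conjTranspose_mul, isU_Sy.herm]
    simp only [Matrix.mul_smul, Matrix.smul_mul, smul_smul, Complex.ofReal_mul, ← hdd.2]
    congr 1
    · ring
    · noncomm_ring

end JT

/-- Main theorem: structure of continuous Jordan triple endomorphisms of ℙ₂. -/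
theorem jordan_triple_endomorphisms_P2
    (φ : Matrix (Fin 2) (Fin 2) ℂ → Matrix (Fin 2) (Fin 2) ℂ)
    (hmaps : ∀ A : Matrix (Fin 2) (Fin 2) ℂ, A.PosDef → (φ A).PosDef)
    (hcont : ContinuousOn φ {A : Matrix (Fin 2) (Fin 2) ℂ | A.PosDef})
    (hjordan : ∀ A B : Matrix (Fin 2) (Fin 2) ℂ, A.PosDef → B.PosDef →
      φ (A * B * A) = φ A * φ B * φ A) :
    (∃ (U : Matrix (Fin 2) (Fin 2) ℂ) (c : ℝ), U * Uᴴ = 1 ∧ Uᴴ * U = 1 ∧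
      ∀ A : Matrix (Fin 2) (Fin 2) ℂ, A.PosDef →
        φ A = ((A.det.re ^ c : ℝ) : ℂ) • (U * A * Uᴴ)) ∨
    (∃ (V : Matrix (Fin 2) (Fin 2) ℂ) (d : ℝ), V * Vᴴ = 1 ∧ Vᴴ * V = 1 ∧
      ∀ A : Matrix (Fin 2) (Fin 2) ℂ, A.PosDef →
        φ A = ((A.det.re ^ d : ℝ) : ℂ) • (V * A⁻¹ * Vᴴ)) ∨
    (∃ (W : Matrix (Fin 2) (Fin 2) ℂ) (c₁ c₂ : ℝ), W * Wᴴ = 1 ∧ Wᴴ * W = 1 ∧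
      ∀ A : Matrix (Fin 2) (Fin 2) ℂ, A.PosDef →
        φ A = W * Matrix.diagonal
          ![((A.det.re ^ c₁ : ℝ) : ℂ), ((A.det.re ^ c₂ : ℝ) : ℂ)] * Wᴴ) := by
  by_cases hs : ∀ l : ℝ, 0 < l → ∃ k : ℝ, φ ((l : ℂ) • 1) = (k : ℂ) • 1
  · obtain ⟨c, h | ⟨U, hU, h | h⟩⟩ := JT.case_scalar hmaps hcont hjordan hs
    · right; right
      refine ⟨1, c, c, by simp, by simp, fun A hA => ?_⟩
      rw [h A hA]
      ext i j; fin_cases i <;> fin_cases j <;> simp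
    · left
      exact ⟨U, c, hU.1, hU.2, h⟩
    · right; left
      exact ⟨U, c, hU.1, hU.2, h⟩
  · right; right
    push Not at hs
    obtain ⟨l, hl, hns⟩ := hs
    have hlp : ((l : ℂ) • (1 : JT.M2)).PosDef := JT.pd_smul JT.pd_one hl
    obtain ⟨W, hW, hall⟩ := JT.simdiag (hmaps _ hlp).1 hns
    obtain ⟨c₁, c₂, h⟩ := JT.case_diag hmaps hcont hjordan hW (fun A hA =>
      hall _ (hmaps A hA).1 (JT.jordan_comm hmaps hjordan hA hlp (by simp)))
    exact ⟨W, c₁, c₂, hW.1, hW.2, h⟩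
end
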